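/- arXiv:1008.5383 — 3 statements merged into one kernel-verified Lean document; each statement's English description precedes it below -/
import Mathlib

section
/- Let X ⊂ S^{m-1} be a finite spherical t-design, and let H_k be the characteristic matrix of degree k (rows indexed by points of X, columns by an orthonormal basis of Harm_k(R^m)). Then for all nonnegative integers k, l with k + l ≤ t, Hₖᵀ H_l = |X|·I if k = l, and Hₖᵀ H_l = 0 if k ≠ l. -/
open MeasureTheory MvPolynomial Finset

/-- The Laplacian on polynomials in `m` variables, as a linear map. -/
noncomputable def polyLaplacian (m : ℕ) :
    MvPolynomial (Fin m) ℝ →ₗ[ℝ] MvPolynomial (Fin m) ℝ :=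
  ∑ j : Fin m, ((pderiv j).toLinearMap ∘ₗ (pderiv j).toLinearMap)

/-- The space of homogeneous harmonic polynomials of degree `k` in `m` variables. -/
noncomputable def Harm (m k : ℕ) : Submodule ℝ (MvPolynomial (Fin m) ℝ) :=
  homogeneousSubmodule (Fin m) ℝ k ⊓ LinearMap.ker (polyLaplacian m)

/-- A finite set of unit vectors `X ⊆ S^{m-1}` is a spherical `t`-design if every
homogeneous harmonic polynomial of degree `1 ≤ i ≤ t` sums to zero over `X`. -/
def IsSphericalDesign (m t : ℕ) (X : Finset (EuclideanSpace ℝ (Fin m))) : Prop :=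
  ∀ i : ℕ, 1 ≤ i → i ≤ t → ∀ p ∈ Harm m i, ∑ x ∈ X, eval (fun j => x j) p = 0

/-- The normalized surface measure on the unit sphere of `ℝ^m`. -/
noncomputable def sphereMeasure (m : ℕ) :
    Measure (Metric.sphere (0 : EuclideanSpace ℝ (Fin m)) 1) :=
  (((volume : Measure (EuclideanSpace ℝ (Fin m))).toSphere) Set.univ)⁻¹ •
    (volume : Measure (EuclideanSpace ℝ (Fin m))).toSphere

noncomputable def rsq (m : ℕ) : MvPolynomial (Fin m) ℝ := ∑ j : Fin m, X j ^ 2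

lemma lap_apply (m : ℕ) (p : MvPolynomial (Fin m) ℝ) :
    polyLaplacian m p = ∑ j : Fin m, pderiv j (pderiv j p) := by
  simp [polyLaplacian, LinearMap.sum_apply]

lemma lap_mul (m : ℕ) (p q : MvPolynomial (Fin m) ℝ) :
    polyLaplacian m (p * q) = polyLaplacian m p * q + 2 * ∑ j, pderiv j p * pderiv j q
      + p * polyLaplacian m q := by
  simp only [lap_apply, pderiv_mul, map_add, Finset.mul_sum, Finset.sum_mul,
    ← Finset.sum_add_distrib]
  refine Finset.sum_congr rfl fun j _ => ?_
  ring

lemma pderiv_rsq (m : ℕ) (i : Fin m) : pderiv i (rsq m) = 2 * X i := by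
  simp only [rsq, map_sum, pderiv_pow]
  rw [Finset.sum_eq_single i]
  · simp
  · intro j _ hj
    simp [pderiv_X_of_ne hj]
  · simp

lemma lap_rsq (m : ℕ) : polyLaplacian m (rsq m) = C (2 * (m : ℝ)) := by
  have h2 : (2 : MvPolynomial (Fin m) ℝ) = C 2 := (map_ofNat C 2).symm
  simp only [lap_apply, pderiv_rsq, h2, pderiv_C_mul, pderiv_X_self]
  simp [mul_comm]

lemma lap_rsq_mul (m n : ℕ) (q : MvPolynomial (Fin m) ℝ) (hq : q.IsHomogeneous n) :
    polyLaplacian m (rsq m * q) = C (2 * (m : ℝ) + 4 * n) * q + rsq m * polyLaplacian m q := by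
  have h := hq.sum_X_mul_pderiv
  rw [lap_mul, lap_rsq]
  simp only [pderiv_rsq, mul_assoc, ← Finset.mul_sum, h]
  simp only [C_add, C_mul, map_natCast, map_ofNat, nsmul_eq_mul]
  ring

lemma rsq_homog (m : ℕ) : (rsq m).IsHomogeneous 2 :=
  IsHomogeneous.sum _ _ _ fun j _ => by simpa using (isHomogeneous_X ℝ j).pow 2

lemma lap_rsq_pow_mul (m n : ℕ) (q : MvPolynomial (Fin m) ℝ) (hq : q.IsHomogeneous n) (j : ℕ) :
    polyLaplacian m (rsq m ^ (j + 1) * q) =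
      C (2 * ((j : ℝ) + 1) * (m + 2 * j + 2 * n)) * (rsq m ^ j * q)
        + rsq m ^ (j + 1) * polyLaplacian m q := by
  induction j with
  | zero =>
    simp only [zero_add, pow_one, pow_zero, one_mul, lap_rsq_mul m n q hq]
    congr 3
    push_cast; ring
  | succ j ih =>
    have hh : (rsq m ^ (j + 1) * q).IsHomogeneous (2 * (j + 1) + n) :=
      ((rsq_homog m).pow (j + 1)).mul hq
    rw [pow_succ' (rsq m) (j + 1), mul_assoc, lap_rsq_mul m _ _ hh, ih]
    push_cast
    simp only [C_add, C_mul, map_natCast, map_ofNat, C_1]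
    ring

lemma lap_homog (m n : ℕ) (q : MvPolynomial (Fin m) ℝ) (hq : q.IsHomogeneous n) :
    (polyLaplacian m q).IsHomogeneous (n - 2) := by
  rw [lap_apply]
  exact IsHomogeneous.sum _ _ _ fun j _ => hq.pderiv.pderiv

lemma lap_iter_homog (m n : ℕ) (q : MvPolynomial (Fin m) ℝ) (hq : q.IsHomogeneous n) (j : ℕ) :
    ((polyLaplacian m)^[j] q).IsHomogeneous (n - 2 * j) := by
  induction j with
  | zero => simpa
  | succ j ih =>
    rw [Function.iterate_succ_apply']
    have := lap_homog m _ _ ih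
    rwa [show n - 2 * (j + 1) = n - 2 * j - 2 by omega]

lemma lap_low (m n : ℕ) (q : MvPolynomial (Fin m) ℝ) (hq : q.IsHomogeneous n) (hn : n < 2) :
    polyLaplacian m q = 0 := by
  rw [lap_apply]
  refine Finset.sum_eq_zero fun j _ => ?_
  have h : (pderiv j q).IsHomogeneous 0 := by
    have := hq.pderiv (i := j)
    rwa [show n - 1 = 0 by omega] at this
  rw [← totalDegree_zero_iff_isHomogeneous, totalDegree_eq_zero_iff_eq_C] at h
  rw [h, pderiv_C]

lemma decomp_aux (m n : ℕ) (hm : 0 < m) (p : MvPolynomial (Fin m) ℝ) (hp : p.IsHomogeneous n)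
    (J : ℕ) (hJ : 2 * J ≤ n) : ∃ (c : ℝ) (q : MvPolynomial (Fin m) ℝ), q.IsHomogeneous (n - 2) ∧
      polyLaplacian m (p + rsq m * q) = C c * (rsq m ^ J * (polyLaplacian m)^[J + 1] p) := by
  induction J with
  | zero => exact ⟨1, 0, isHomogeneous_zero _ _ _, by simp⟩
  | succ J ih =>
    obtain ⟨c, q, hq, h⟩ := ih (by omega)
    set u := (polyLaplacian m)^[J + 1] p with hu
    have huh : u.IsHomogeneous (n - 2 * (J + 1)) := lap_iter_homog m n p hp (J + 1)
    set a : ℝ := 2 * ((J : ℝ) + 1) * (m + 2 * J + 2 * (n - 2 * (J + 1) : ℕ)) with ha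
    have ha0 : a ≠ 0 := by
      have : (0 : ℝ) < m := by exact_mod_cast hm
      positivity
    refine ⟨-c / a, q + C (-c / a) * (rsq m ^ J * u), hq.add ?_, ?_⟩
    · have := (((rsq_homog m).pow J).mul huh).C_mul (-c / a)
      rwa [show 2 * J + (n - 2 * (J + 1)) = n - 2 by omega] at this
    · have e : p + rsq m * (q + C (-c / a) * (rsq m ^ J * u))
          = (p + rsq m * q) + (-c / a) • (rsq m ^ (J + 1) * u) := by
        rw [smul_eq_C_mul]; ring
      rw [e, map_add, h, map_smul, lap_rsq_pow_mul m _ u huh, ← ha,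
        Function.iterate_succ_apply' _ (J + 1), ← hu, smul_eq_C_mul, mul_add,
        ← mul_assoc (C (-c / a)) (C a), ← C_mul, div_mul_cancel₀ _ ha0, C_neg]
      ring

lemma decomp (m n : ℕ) (hm : 0 < m) (p : MvPolynomial (Fin m) ℝ) (hp : p.IsHomogeneous n) :
    ∃ q : MvPolynomial (Fin m) ℝ, q.IsHomogeneous (n - 2) ∧
      polyLaplacian m (p + rsq m * q) = 0 := by
  obtain ⟨c, q, hq, h⟩ := decomp_aux m n hm p hp (n / 2) (by omega)
  refine ⟨q, hq, ?_⟩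
  rw [h, Function.iterate_succ_apply',
    lap_low m _ _ (lap_iter_homog m n p hp (n / 2)) (by omega)]
  simp

/-- Evaluation of a polynomial at a point of Euclidean space. -/
noncomputable def ev {m : ℕ} (p : MvPolynomial (Fin m) ℝ) (x : EuclideanSpace ℝ (Fin m)) : ℝ :=
  eval (fun a => x a) p

lemma ev_continuous {m : ℕ} (p : MvPolynomial (Fin m) ℝ) : Continuous (ev p) := by
  unfold ev
  exact (MvPolynomial.continuous_eval p).comp (by fun_prop)

lemma ev_lineDeriv {m : ℕ} (p : MvPolynomial (Fin m) ℝ) (i : Fin m)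
    (x : EuclideanSpace ℝ (Fin m)) :
    HasLineDerivAt ℝ (ev p) (ev (pderiv i p) x) x (EuclideanSpace.single i 1) := by
  unfold HasLineDerivAt ev
  induction p using MvPolynomial.induction_on with
  | C a => simpa using hasDerivAt_const (0 : ℝ) a
  | add p q hp hq => simpa using! hp.add hq
  | mul_X p j hp =>
    have hX : HasDerivAt (fun t : ℝ => (x + t • EuclideanSpace.single i (1 : ℝ)) j)
        (if j = i then 1 else 0) 0 := by
      have := ((hasDerivAt_id (0 : ℝ)).mul_const (if j = i then (1 : ℝ) else 0)).const_add (x j)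
      simpa [Pi.single_apply] using this
    have h := hp.mul hX
    have e : eval (fun a => x a) (pderiv i (p * X j)) =
        eval (fun a => x a) (pderiv i p) * (x + (0 : ℝ) • EuclideanSpace.single i (1 : ℝ)) j +
        eval (fun a => (x + (0 : ℝ) • EuclideanSpace.single i (1 : ℝ)) a) p *
          (if j = i then 1 else 0) := by
      rw [pderiv_mul]
      by_cases hji : j = i
      · subst hji; simp
      · simp [pderiv_X_of_ne hji, hji]
    rw [e]
    simpa using! h

lemma hasDerivAt_max_sq (u : ℝ) :
    HasDerivAt (fun u : ℝ => (max u 0) ^ 2) (2 * max u 0) u := by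
  rcases lt_trichotomy u 0 with h | h | h
  · rw [max_eq_right h.le]
    have : HasDerivAt (fun _ : ℝ => (0 : ℝ)) 0 u := hasDerivAt_const _ _
    simp only [mul_zero]
    refine this.congr_of_eventuallyEq ?_
    filter_upwards [Iio_mem_nhds h] with y hy
    rw [max_eq_right (le_of_lt hy)]; simp
  · subst h
    rw [hasDerivAt_iff_isLittleO_nhds_zero]
    simp only [zero_add, max_self, mul_zero, smul_zero, sub_zero]
    refine Asymptotics.IsBigO.trans_isLittleO (g := fun h : ℝ => h ^ 2) ?_ ?_
    · refine Asymptotics.IsBigO.of_bound 1 (Filter.Eventually.of_forall fun y => ?_)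
      simp only [Real.norm_eq_abs, abs_pow, one_mul]
      have : |max y 0| ≤ |y| := by
        rcases le_total y 0 with hy | hy
        · simp [max_eq_right hy]
        · simp [max_eq_left hy]
      simp only [ne_eq, OfNat.ofNat_ne_zero, not_false_eq_true, zero_pow, sub_zero, abs_pow]
      gcongr
    · simpa using (Asymptotics.isLittleO_pow_id (𝕜 := ℝ) (n := 2) (by norm_num))
  · rw [max_eq_left h.le]
    have : HasDerivAt (fun y : ℝ => y ^ 2) (2 * u) u := by simpa using hasDerivAt_pow 2 u
    refine this.congr_of_eventuallyEq ?_
    filter_upwards [Ioi_mem_nhds h] with y hy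
    rw [max_eq_left (le_of_lt hy)]

/-- The radial profile `max (1 - r²) 0`. -/
noncomputable def prof (r : ℝ) : ℝ := max (1 - r ^ 2) 0

lemma prof_continuous : Continuous prof := by unfold prof; fun_prop

lemma wt_lineDeriv {m : ℕ} (i : Fin m) (x : EuclideanSpace ℝ (Fin m)) :
    HasLineDerivAt ℝ (fun x : EuclideanSpace ℝ (Fin m) => prof ‖x‖ ^ 2)
      (-4 * x i * prof ‖x‖) x (EuclideanSpace.single i 1) := by
  unfold HasLineDerivAt prof
  have e : ∀ t : ℝ, 1 - ‖x + t • EuclideanSpace.single i (1 : ℝ)‖ ^ 2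
      = 1 - (‖x‖ ^ 2 + 2 * t * x i + t ^ 2) := by
    intro t
    rw [norm_add_sq_real, norm_smul, inner_smul_right]
    simp [EuclideanSpace.inner_single_right]
    ring
  simp only [e]
  have h1 : HasDerivAt (fun t : ℝ => 1 - (‖x‖ ^ 2 + 2 * t * x i + t ^ 2)) (-(2 * x i)) 0 := by
    have a := ((((hasDerivAt_id (0 : ℝ)).const_mul 2).mul_const (x i)).const_add (‖x‖ ^ 2)).add
      (hasDerivAt_pow 2 (0 : ℝ))
    simpa using a.const_sub 1
  have := (hasDerivAt_max_sq (1 - (‖x‖ ^ 2 + 2 * 0 * x i + 0 ^ 2))).comp (0 : ℝ) h1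
  convert! this using 1
  simp; ring

lemma prof_compact {m : ℕ} :
    HasCompactSupport (fun x : EuclideanSpace ℝ (Fin m) => prof ‖x‖) := by
  refine HasCompactSupport.intro (isCompact_closedBall (0 : EuclideanSpace ℝ (Fin m)) 1) ?_
  intro x hx
  simp only [Metric.mem_closedBall, dist_zero_right, not_le] at hx
  unfold prof
  rw [max_eq_right]
  nlinarith

lemma integrable_prof {m : ℕ} (f : EuclideanSpace ℝ (Fin m) → ℝ) (hf : Continuous f) :
    Integrable (fun x => f x * prof ‖x‖) := by
  refine Continuous.integrable_of_hasCompactSupport ?_ ?_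
  · exact hf.mul (prof_continuous.comp continuous_norm)
  · exact prof_compact.mul_left

lemma parts {m : ℕ} (p : MvPolynomial (Fin m) ℝ) (i : Fin m) :
    ∫ x : EuclideanSpace ℝ (Fin m), ev p x * (-4 * x i * prof ‖x‖)
      = - ∫ x : EuclideanSpace ℝ (Fin m), ev (pderiv i p) x * prof ‖x‖ ^ 2 := by
  have c1 := ev_continuous p
  have c2 := ev_continuous (pderiv i p)
  have c3 : Continuous (fun x : EuclideanSpace ℝ (Fin m) => prof ‖x‖) :=
    prof_continuous.comp continuous_norm
  refine integral_bilinear_hasLineDerivAt_right_eq_neg_left_of_integrable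
    (B := ContinuousLinearMap.mul ℝ ℝ) (f := ev p) (f' := ev (pderiv i p))
    (g := fun x : EuclideanSpace ℝ (Fin m) => prof ‖x‖ ^ 2)
    (g' := fun x => -4 * x i * prof ‖x‖) (v := EuclideanSpace.single i 1)
    ?_ ?_ ?_ (fun x _ => ev_lineDeriv p i x) (fun x _ => wt_lineDeriv i x)
  · have := integrable_prof (fun x => ev (pderiv i p) x * prof ‖x‖) (c2.mul c3)
    refine this.congr (Filter.Eventually.of_forall fun x => ?_)
    simp; ring
  · have := integrable_prof (fun x => ev p x * (-4 * x i)) (by fun_prop)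
    refine this.congr (Filter.Eventually.of_forall fun x => ?_)
    simp; ring
  · have := integrable_prof (fun x => ev p x * prof ‖x‖) (c1.mul c3)
    refine this.congr (Filter.Eventually.of_forall fun x => ?_)
    simp; ring

/-- A divergence-free polynomial field has vanishing weighted radial component. -/
lemma div_free {m : ℕ} (F : Fin m → MvPolynomial (Fin m) ℝ) (hF : ∑ i, pderiv i (F i) = 0) :
    ∫ x : EuclideanSpace ℝ (Fin m), ev (∑ i, X i * F i) x * prof ‖x‖ = 0 := by
  have c3 : Continuous (fun x : EuclideanSpace ℝ (Fin m) => prof ‖x‖) :=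
    prof_continuous.comp continuous_norm
  have h1 : ∑ i, ∫ x : EuclideanSpace ℝ (Fin m), ev (F i) x * (-4 * x i * prof ‖x‖) = 0 := by
    simp only [parts, Finset.sum_neg_distrib, neg_eq_zero]
    rw [← integral_finsetSum]
    · simp only [← Finset.sum_mul]
      have : ∀ x : EuclideanSpace ℝ (Fin m), ∑ i, ev (pderiv i (F i)) x = 0 := by
        intro x
        simp only [ev, ← map_sum, hF, map_zero]
      simp [this]
    · intro i _
      have := integrable_prof (fun x => ev (pderiv i (F i)) x * prof ‖x‖)
        ((ev_continuous _).mul c3)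
      refine this.congr (Filter.Eventually.of_forall fun x => ?_)
      simp; ring
  rw [← integral_finsetSum] at h1
  · have e : ∀ x : EuclideanSpace ℝ (Fin m), ∑ i, ev (F i) x * (-4 * x i * prof ‖x‖)
        = -4 * (ev (∑ i, X i * F i) x * prof ‖x‖) := by
      intro x
      simp only [ev, map_sum, map_mul, eval_X, Finset.sum_mul, Finset.mul_sum]
      refine Finset.sum_congr rfl fun i _ => ?_
      ring
    simp only [e, integral_const_mul] at h1
    linarith
  · intro i _
    have := integrable_prof (fun x => ev (F i) x * (-4 * x i))
      ((ev_continuous _).mul (by fun_prop))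
    refine this.congr (Filter.Eventually.of_forall fun x => ?_)
    simp; ring

lemma polar {m : ℕ} (G : EuclideanSpace ℝ (Fin m) → ℝ)
    (f : Metric.sphere (0 : EuclideanSpace ℝ (Fin m)) 1 → ℝ) (g : ℝ → ℝ) (hm : 0 < m)
    (h : ∀ (y : Metric.sphere (0 : EuclideanSpace ℝ (Fin m)) 1) (r : ℝ), 0 < r →
      G (r • (y : EuclideanSpace ℝ (Fin m))) = f y * g r) :
    ∫ x, G x = (∫ y, f y ∂(volume : Measure (EuclideanSpace ℝ (Fin m))).toSphere) *
      ∫ r : Set.Ioi (0 : ℝ), g r ∂(Measure.volumeIoiPow (m - 1)) := by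
  have : Nonempty (Fin m) := ⟨⟨0, hm⟩⟩
  have hmp := (volume : Measure (EuclideanSpace ℝ (Fin m))).measurePreserving_homeomorphUnitSphereProd
  rw [finrank_euclideanSpace_fin] at hmp
  rw [← integral_prod_mul f (fun r : Set.Ioi (0 : ℝ) => g r)]
  rw [← hmp.integral_comp (Homeomorph.measurableEmbedding _)]
  have : ∫ x, G x = ∫ x : ({(0)}ᶜ : Set (EuclideanSpace ℝ (Fin m))), G x.1
      ∂((volume : Measure (EuclideanSpace ℝ (Fin m))).comap (↑)) := by
    rw [integral_subtype_comap (measurableSet_singleton _).compl fun x ↦ G x,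
        restrict_compl_singleton]
  rw [this]
  refine integral_congr_ae (Filter.Eventually.of_forall fun x => ?_)
  have hx := h (homeomorphUnitSphereProd (EuclideanSpace ℝ (Fin m)) x).1
    (homeomorphUnitSphereProd (EuclideanSpace ℝ (Fin m)) x).2
    (homeomorphUnitSphereProd (EuclideanSpace ℝ (Fin m)) x).2.2
  simp only
  rw [← hx]
  congr 1
  have hx0 : ‖(x : EuclideanSpace ℝ (Fin m))‖ ≠ 0 := norm_ne_zero_iff.2 x.2
  simp [smul_smul, mul_inv_cancel₀ hx0]

lemma ev_smul {m n : ℕ} (p : MvPolynomial (Fin m) ℝ) (hp : p.IsHomogeneous n) (r : ℝ)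
    (x : EuclideanSpace ℝ (Fin m)) : ev p (r • x) = r ^ n * ev p x := by
  unfold ev
  have e : (fun a => (r • x) a) = r • (fun a => x a) := by ext; simp
  rw [e]
  simp only [eval_eq', Finset.mul_sum]
  refine Finset.sum_congr rfl fun d hd => ?_
  have hdeg : ∑ i, d i = n := by
    have := hp (mem_support_iff.1 hd)
    simpa [Finsupp.weight_apply, Finsupp.sum_fintype] using this
  simp only [Pi.smul_apply, smul_eq_mul, mul_pow, Finset.prod_mul_distrib, Finset.prod_pow_eq_pow_sum,
    hdeg]
  ring

lemma toSphere_zero {m n : ℕ} (hm : 0 < m) (p : MvPolynomial (Fin m) ℝ) (hp : p.IsHomogeneous n)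
    (h : ∫ x : EuclideanSpace ℝ (Fin m), ev p x * prof ‖x‖ = 0) :
    ∫ y : Metric.sphere (0 : EuclideanSpace ℝ (Fin m)) 1, ev p y
      ∂(volume : Measure (EuclideanSpace ℝ (Fin m))).toSphere = 0 := by
  have : Nonempty (Fin m) := ⟨⟨0, hm⟩⟩
  rw [polar _ (fun y => ev p y) (fun r => r ^ n * prof r) hm] at h
  · refine (mul_eq_zero.1 h).resolve_right fun h0 => ?_
    have h2 := polar (fun x : EuclideanSpace ℝ (Fin m) => ‖x‖ ^ n * prof ‖x‖) (fun _ => 1)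
      (fun r => r ^ n * prof r) hm (by
        intro y r hr
        simp [norm_smul, abs_of_pos hr])
    rw [h0, mul_zero] at h2
    have hpos : 0 < ∫ x : EuclideanSpace ℝ (Fin m), ‖x‖ ^ n * prof ‖x‖ := by
      refine Continuous.integral_pos_of_hasCompactSupport_nonneg_nonzero
        (x := EuclideanSpace.single ⟨0, hm⟩ (1 / 2 : ℝ)) ?_ ?_ ?_ ?_
      · exact (continuous_norm.pow n).mul (prof_continuous.comp continuous_norm)
      · exact prof_compact.mul_left
      · intro x
        have : 0 ≤ prof ‖x‖ := le_max_right _ _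
        positivity
      · simp only [EuclideanSpace.norm_single, prof]
        norm_num
    exact hpos.ne' h2
  · intro y r hr
    rw [ev_smul p hp]
    simp [norm_smul, abs_of_pos hr]
    ring

lemma ortho {m k l : ℕ} (hm : 0 < m) (p q : MvPolynomial (Fin m) ℝ) (hp : p ∈ Harm m k)
    (hq : q ∈ Harm m l) (hkl : k ≠ l) :
    ∫ y : Metric.sphere (0 : EuclideanSpace ℝ (Fin m)) 1, ev (p * q) y ∂(sphereMeasure m) = 0 := by
  obtain ⟨hp1, hp2⟩ := hp
  obtain ⟨hq1, hq2⟩ := hq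
  have hp1 : p.IsHomogeneous k := hp1
  have hq1 : q.IsHomogeneous l := hq1
  have hp2 : polyLaplacian m p = 0 := hp2
  have hq2 : polyLaplacian m q = 0 := hq2
  rw [lap_apply] at hp2 hq2
  have h := div_free (fun i => p * pderiv i q - q * pderiv i p) (by
    have : ∀ i, pderiv i (p * pderiv i q - q * pderiv i p)
        = p * pderiv i (pderiv i q) - q * pderiv i (pderiv i p) := by
      intro i
      simp only [map_sub, pderiv_mul]
      ring
    simp only [this, Finset.sum_sub_distrib, ← Finset.mul_sum, hp2, hq2]
    simp)
  have e : ∑ i, X i * (p * pderiv i q - q * pderiv i p) = C ((l : ℝ) - k) * (p * q) := by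
    have e1 : ∀ i, X i * (p * pderiv i q - q * pderiv i p) =
      p * (X i * pderiv i q) - q * (X i * pderiv i p) := fun i => by ring
    simp only [e1, Finset.sum_sub_distrib, ← Finset.mul_sum, hp1.sum_X_mul_pderiv,
      hq1.sum_X_mul_pderiv]
    simp only [nsmul_eq_mul, C_sub, map_natCast]
    ring
  have h' : ∫ x : EuclideanSpace ℝ (Fin m), ev (p * q) x * prof ‖x‖ = 0 := by
    rw [e] at h
    have : ∀ x : EuclideanSpace ℝ (Fin m), ev (C ((l : ℝ) - k) * (p * q)) x * prof ‖x‖ =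
        ((l : ℝ) - k) * (ev (p * q) x * prof ‖x‖) := by
      intro x
      simp only [ev, map_mul, eval_C]; ring
    simp only [this, integral_const_mul] at h
    refine (mul_eq_zero.1 h).resolve_left ?_
    rw [sub_eq_zero]
    exact_mod_cast hkl.symm
  rw [sphereMeasure, integral_smul_measure, toSphere_zero hm _ (hp1.mul hq1) h', smul_zero]

lemma ev_rsq {m : ℕ} (x : EuclideanSpace ℝ (Fin m)) (hx : ‖x‖ = 1) : ev (rsq m) x = 1 := by
  have : ‖x‖ ^ 2 = 1 := by rw [hx]; norm_num
  rw [EuclideanSpace.norm_sq_eq] at this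
  simpa [ev, rsq] using this

lemma sphereMeasure_prob {m : ℕ} (hm : 0 < m) : IsProbabilityMeasure (sphereMeasure m) := by
  have : Nonempty (Fin m) := ⟨⟨0, hm⟩⟩
  constructor
  rw [sphereMeasure, Measure.smul_apply, smul_eq_mul]
  refine ENNReal.inv_mul_cancel ?_ (measure_ne_top _ _)
  rw [Ne, Measure.measure_univ_eq_zero]
  exact Measure.toSphere_ne_zero _

lemma average {m t : ℕ} (hm : 0 < m) (X : Finset (EuclideanSpace ℝ (Fin m)))
    (hX : ∀ x ∈ X, ‖x‖ = 1) (hdesign : IsSphericalDesign m t X) (n : ℕ) :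
    n ≤ t → ∀ p : MvPolynomial (Fin m) ℝ, p.IsHomogeneous n →
    ∑ x ∈ X, ev p x = X.card *
      ∫ y : Metric.sphere (0 : EuclideanSpace ℝ (Fin m)) 1, ev p y ∂(sphereMeasure m) := by
  have := sphereMeasure_prob hm
  -- harmonic polynomials of positive degree
  have hharm : ∀ n, 1 ≤ n → n ≤ t → ∀ p ∈ Harm m n, ∑ x ∈ X, ev p x = X.card *
      ∫ y : Metric.sphere (0 : EuclideanSpace ℝ (Fin m)) 1, ev p y ∂(sphereMeasure m) := by
    intro n h1 h2 p hp
    have a := hdesign n h1 h2 p hp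
    have b := ortho hm p 1 hp (l := 0)
      ⟨isHomogeneous_one _ _, by
        change polyLaplacian m 1 = 0
        rw [lap_apply]; simp⟩ (by omega)
    rw [mul_one] at b
    rw [b, mul_zero]
    exact a
  have hint : ∀ p : MvPolynomial (Fin m) ℝ, Integrable
      (fun y : Metric.sphere (0 : EuclideanSpace ℝ (Fin m)) 1 => ev p y) (sphereMeasure m) := by
    intro p
    exact ((ev_continuous p).comp continuous_subtype_val).integrable_of_hasCompactSupport
      (HasCompactSupport.of_compactSpace _)
  induction n using Nat.strong_induction_on with
  | _ n ih =>
    intro hn p hp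
    rcases Nat.lt_or_ge n 2 with h2 | h2
    · rcases Nat.eq_zero_or_pos n with h0 | h0
      · subst h0
        rw [← totalDegree_zero_iff_isHomogeneous, totalDegree_eq_zero_iff_eq_C] at hp
        rw [hp]
        simp [ev]
      · exact hharm n h0 hn p ⟨hp, lap_low m n p hp h2⟩
    · obtain ⟨q, hq, h⟩ := decomp m n hm p hp
      have hrq : (rsq m * q).IsHomogeneous n := by
        have := (rsq_homog m).mul hq
        rwa [show 2 + (n - 2) = n by omega] at this
      have a := hharm n (by omega) hn (p + rsq m * q) ⟨hp.add hrq, h⟩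
      have b := ih (n - 2) (by omega) (by omega) q hq
      have e : ∀ x : EuclideanSpace ℝ (Fin m), ‖x‖ = 1 →
          ev (p + rsq m * q) x = ev p x + ev q x := by
        intro x hx
        have := ev_rsq x hx
        simp only [ev, map_add, map_mul] at this ⊢
        rw [this, one_mul]
      rw [Finset.sum_congr rfl fun x hx => e x (hX x hx), Finset.sum_add_distrib, b] at a
      have e2 : ∀ y : Metric.sphere (0 : EuclideanSpace ℝ (Fin m)) 1,
          ev (p + rsq m * q) y = ev p y + ev q y := fun y => e y (by simp)
      simp only [e2] at a
      rw [integral_add (hint p) (hint q), mul_add] at a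
      linarith

/-- Delsarte–Goethals–Seidel: if `X ⊆ S^{m-1}` is a spherical `t`-design and `H k`
denotes the characteristic matrix of degree `k` (with respect to orthonormal bases
`φ k` of `Harm_k(ℝ^m)` for the normalized surface measure), then for `k + l ≤ t` one has
`Hₖᵀ H_l = |X| • I` if `k = l` and `Hₖᵀ H_l = 0` if `k ≠ l`. -/
theorem characteristic_matrix_design (m t : ℕ)
    (X : Finset (EuclideanSpace ℝ (Fin m))) (hX : ∀ x ∈ X, ‖x‖ = 1)
    (hdesign : IsSphericalDesign m t X)
    (d : ℕ → ℕ) (φ : (k : ℕ) → Fin (d k) → MvPolynomial (Fin m) ℝ)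
    (hmem : ∀ k ≤ t, ∀ i, φ k i ∈ Harm m k)
    (hspan : ∀ k ≤ t, ∀ p ∈ Harm m k, p ∈ Submodule.span ℝ (Set.range (φ k)))
    (hortho : ∀ k ≤ t, ∀ i j : Fin (d k),
      ∫ x : Metric.sphere (0 : EuclideanSpace ℝ (Fin m)) 1,
        (eval (fun a => (x : EuclideanSpace ℝ (Fin m)) a) (φ k i)) *
        (eval (fun a => (x : EuclideanSpace ℝ (Fin m)) a) (φ k j)) ∂(sphereMeasure m)
        = if i = j then 1 else 0)
    (H : (k : ℕ) → Matrix ↥X (Fin (d k)) ℝ)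
    (hH : ∀ k, H k = Matrix.of fun (x : ↥X) i => eval (fun a => (x : EuclideanSpace ℝ (Fin m)) a) (φ k i)) :
    (∀ k l : ℕ, k + l ≤ t → k ≠ l → (H k).transpose * (H l) = 0) ∧
    (∀ k : ℕ, k + k ≤ t → (H k).transpose * (H k) = (X.card : ℝ) • 1) := by
  have key : ∀ k l : ℕ, k + l ≤ t → ∀ i j, ((H k).transpose * (H l)) i j = X.card *
      ∫ y : Metric.sphere (0 : EuclideanSpace ℝ (Fin m)) 1,
        ev (φ k i * φ l j) y ∂(sphereMeasure m) := by
    intro k l hkl i j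
    have e : ((H k).transpose * (H l)) i j = ∑ x ∈ X, ev (φ k i * φ l j) x := by
      rw [← Finset.sum_coe_sort X (fun x => ev (φ k i * φ l j) x)]
      simp [Matrix.mul_apply, hH, ev]
    rw [e]
    rcases Nat.eq_zero_or_pos m with hm | hm
    · have hXe : X = ∅ := by
        refine Finset.eq_empty_of_forall_notMem fun x hx => ?_
        have h1 := hX x hx
        subst hm
        rw [Subsingleton.elim x 0, norm_zero] at h1
        exact zero_ne_one h1
      subst hXe
      simp
    · have h1 : (φ k i).IsHomogeneous k := (hmem k (by omega) i).1
      have h2 : (φ l j).IsHomogeneous l := (hmem l (by omega) j).1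
      exact average hm X hX hdesign (k + l) hkl _ (h1.mul h2)
  constructor
  · intro k l hkl hne
    ext i j
    rw [key k l hkl i j]
    rcases Nat.eq_zero_or_pos m with hm | hm
    · subst hm
      have : IsEmpty (Metric.sphere (0 : EuclideanSpace ℝ (Fin 0)) 1) := by
        refine ⟨fun y => ?_⟩
        have h1 : ‖(y : EuclideanSpace ℝ (Fin 0))‖ = 1 := by simp
        rw [Subsingleton.elim (y : EuclideanSpace ℝ (Fin 0)) 0, norm_zero] at h1
        exact zero_ne_one h1
      simp [Measure.eq_zero_of_isEmpty]
    · rw [ortho hm _ _ (hmem k (by omega) i) (hmem l (by omega) j) hne, mul_zero]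
      rfl
  · intro k hk
    ext i j
    rw [key k k hk i j]
    have := hortho k (by omega) i j
    simp only [ev, map_mul]
    rw [this]
    simp [Matrix.smul_apply, Matrix.one_apply]
end

section
/- Let X ⊂ S^{m-1} be an s-distance set with strength 2s-i, where 2 ≤ i ≤ s+1. Then |X| ≤ ∑_{k=0}^s h_k − h_{s-i+1}, where h_k = C(m+k-1,k) − C(m+k-3,k-2) is the dimension of degree-k spherical harmonics on S^{m-1}. -/
open Polynomial Finset
open scoped RealInnerProductSpace Classical

/-- `lamG m k = k / (m + 2k - 2)`, the coefficients in the Gegenbauer recurrence. -/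
noncomputable def lamG (m k : ℕ) : ℝ := (k : ℝ) / ((m : ℝ) + 2 * k - 2)

/-- The Gegenbauer polynomials for `S^{m-1}`, normalized so that `geg m k` has value
`dim Harm_k(ℝ^m)` at `1`: `G_0 = 1`, `G_1 = m X`, and
`X * G_k = lamG (k+1) • G_{k+1} + (1 - lamG (k-1)) • G_{k-1}`. -/
noncomputable def geg (m : ℕ) : ℕ → Polynomial ℝ
  | 0 => 1
  | 1 => Polynomial.C (m : ℝ) * Polynomial.X
  | (k + 2) => (lamG m (k + 2))⁻¹ •
      (Polynomial.X * geg m (k + 1) - (1 - lamG m k) • geg m k)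

/-- The set of inner products between distinct points of `X`. -/
noncomputable def innerSet (m : ℕ) (X : Finset (EuclideanSpace ℝ (Fin m))) : Finset ℝ :=
  ((X ×ˢ X).filter fun p => p.1 ≠ p.2).image fun p => ⟪p.1, p.2⟫

/-- `X` is a spherical `t`-design iff `∑_{x,y ∈ X} G_i(⟨x,y⟩) = 0` for `1 ≤ i ≤ t`. -/
noncomputable def IsGegDesign (m t : ℕ) (X : Finset (EuclideanSpace ℝ (Fin m))) : Prop :=
  ∀ i : ℕ, 1 ≤ i → i ≤ t → ∑ x ∈ X, ∑ y ∈ X, (geg m i).eval ⟪x, y⟫ = 0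

/-- `hdim m k = dim Harm_k(ℝ^m) = C(m+k-1, k) - C(m+k-3, k-2)`. -/
def hdim (m k : ℕ) : ℕ :=
  (m + k - 1).choose k - if 2 ≤ k then (m + k - 3).choose (k - 2) else 0


abbrev MP (m : ℕ) := MvPolynomial (Fin m) ℝ

/-- Laplacian on polynomials. -/
noncomputable def lap (m : ℕ) : MP m →ₗ[ℝ] MP m :=
  ∑ i : Fin m, ((MvPolynomial.pderiv i : Derivation ℝ (MP m) (MP m)) : MP m →ₗ[ℝ] MP m) ∘ₗ
    ((MvPolynomial.pderiv i : Derivation ℝ (MP m) (MP m)) : MP m →ₗ[ℝ] MP m)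

/-- The squared norm polynomial. -/
noncomputable def r2 (m : ℕ) : MP m := ∑ i : Fin m, MvPolynomial.X i * MvPolynomial.X i

/-- Linear form attached to `w`. -/
noncomputable def lin {m : ℕ} (w : EuclideanSpace ℝ (Fin m)) : MP m :=
  ∑ i : Fin m, w i • MvPolynomial.X i

/-- Directional derivative along `w`. -/
noncomputable def dd {m : ℕ} (w : EuclideanSpace ℝ (Fin m)) : Derivation ℝ (MP m) (MP m) :=
  ∑ i : Fin m, w i • MvPolynomial.pderiv i

lemma lap_apply_s12 (m : ℕ) (p : MP m) :
    lap m p = ∑ i : Fin m, MvPolynomial.pderiv i (MvPolynomial.pderiv i p) := by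
  simp [lap, LinearMap.sum_apply]

lemma dd_apply {m : ℕ} (w : EuclideanSpace ℝ (Fin m)) (p : MP m) :
    dd w p = ∑ i : Fin m, w i • MvPolynomial.pderiv i p := by
  simp only [dd]
  rw [← Derivation.coeFnAddMonoidHom_apply, map_sum, Finset.sum_apply]
  rfl

lemma pderiv_lin {m : ℕ} (w : EuclideanSpace ℝ (Fin m)) (i : Fin m) :
    MvPolynomial.pderiv i (lin w) = MvPolynomial.C (w i) := by
  simp only [lin, map_sum, Derivation.map_smul, MvPolynomial.pderiv_X]
  rw [Finset.sum_eq_single i]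
  · simp [MvPolynomial.smul_eq_C_mul]
  · intro j _ hj
    simp [Pi.single_apply, hj, hj.symm]
  · simp

lemma pderiv_r2 (m : ℕ) (i : Fin m) :
    MvPolynomial.pderiv i (r2 m) = 2 * MvPolynomial.X i := by
  simp only [r2, map_sum, MvPolynomial.pderiv_mul, MvPolynomial.pderiv_X]
  rw [Finset.sum_eq_single i]
  · simp; ring
  · intro j _ hj
    simp [Pi.single_apply, hj, hj.symm]
  · simp

lemma dd_lin {m : ℕ} (w : EuclideanSpace ℝ (Fin m)) (hw : ‖w‖ = 1) : dd w (lin w) = 1 := by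
  rw [dd_apply]
  simp only [pderiv_lin, MvPolynomial.smul_eq_C_mul, ← MvPolynomial.C_mul, ← map_sum]
  have : ∑ i, w i * w i = 1 := by
    have h := EuclideanSpace.real_norm_sq_eq w
    rw [hw] at h
    simp only [← pow_two, ← h]; norm_num
  rw [this]; simp

lemma dd_r2 {m : ℕ} (w : EuclideanSpace ℝ (Fin m)) : dd w (r2 m) = (2:ℝ) • lin w := by
  rw [dd_apply, lin, Finset.smul_sum]
  refine Finset.sum_congr rfl fun i _ => ?_
  rw [pderiv_r2, smul_comm, two_smul, two_mul, smul_add]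

lemma lap_lin_mul {m : ℕ} (w : EuclideanSpace ℝ (Fin m)) (p : MP m) :
    lap m (lin w * p) = lin w * lap m p + (2:ℝ) • dd w p := by
  simp only [lap_apply_s12, dd_apply, MvPolynomial.pderiv_mul, pderiv_lin, map_add,
    MvPolynomial.pderiv_C, MvPolynomial.smul_eq_C_mul, Finset.mul_sum, ← Finset.sum_add_distrib]
  refine Finset.sum_congr rfl fun i _ => ?_
  rw [show (MvPolynomial.C (2:ℝ) : MP m) = 2 from (map_ofNat MvPolynomial.C 2)]
  ring

lemma lap_r2_mul {m k : ℕ} (p : MP m) (hp : p.IsHomogeneous k) :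
    lap m (r2 m * p) = r2 m * lap m p + (2 * (m:ℝ) + 4 * k) • p := by
  have e := hp.sum_X_mul_pderiv
  have : lap m (r2 m * p) = r2 m * lap m p + (2 * (m : MP m)) * p +
      4 * ∑ i, MvPolynomial.X i * MvPolynomial.pderiv i p := by
    have h1 : (2 * (m : MP m)) * p = ∑ i : Fin m, 2 * p := by simp; ring
    have h2 : ∀ i : Fin m, MvPolynomial.pderiv i (2 : MP m) = 0 := fun i => by
      rw [show (2 : MP m) = MvPolynomial.C (2:ℝ) from (map_ofNat MvPolynomial.C 2).symm, MvPolynomial.pderiv_C]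
    rw [h1]
    simp only [lap_apply_s12, MvPolynomial.pderiv_mul, pderiv_r2, map_add, h2,
      MvPolynomial.pderiv_X_self, Finset.mul_sum, ← Finset.sum_add_distrib]
    refine Finset.sum_congr rfl fun i _ => ?_
    ring
  rw [this, e, MvPolynomial.smul_eq_C_mul]
  have c2 : (MvPolynomial.C (2:ℝ) : MP m) = 2 := map_ofNat MvPolynomial.C 2
  have c4 : (MvPolynomial.C (4:ℝ) : MP m) = 4 := map_ofNat MvPolynomial.C 4
  simp [nsmul_eq_mul, c2, c4]; ring

lemma lin_hom {m : ℕ} (w : EuclideanSpace ℝ (Fin m)) : (lin w).IsHomogeneous 1 := by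
  refine MvPolynomial.IsHomogeneous.sum _ _ _ fun i _ => ?_
  rw [MvPolynomial.smul_eq_C_mul]
  exact (MvPolynomial.isHomogeneous_X ℝ i).C_mul _

lemma r2_hom (m : ℕ) : (r2 m).IsHomogeneous 2 :=
  MvPolynomial.IsHomogeneous.sum _ _ _ fun i _ =>
    (MvPolynomial.isHomogeneous_X ℝ i).mul (MvPolynomial.isHomogeneous_X ℝ i)

lemma dd_hom {m k : ℕ} (w : EuclideanSpace ℝ (Fin m)) {p : MP m} (hp : p.IsHomogeneous k) :
    (dd w p).IsHomogeneous (k - 1) := by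
  rw [dd_apply]
  refine MvPolynomial.IsHomogeneous.sum _ _ _ fun i _ => ?_
  rw [MvPolynomial.smul_eq_C_mul]
  exact hp.pderiv.C_mul _

lemma lap_hom {m k : ℕ} {p : MP m} (hp : p.IsHomogeneous k) :
    (lap m p).IsHomogeneous (k - 2) := by
  rw [lap_apply_s12]
  exact MvPolynomial.IsHomogeneous.sum _ _ _ fun i _ => hp.pderiv.pderiv

/-- evaluation at a vector. -/
noncomputable def evl {m : ℕ} (x : EuclideanSpace ℝ (Fin m)) : MP m →ₐ[ℝ] ℝ :=
  MvPolynomial.aeval (fun i => x i)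

lemma evl_lin {m : ℕ} (x w : EuclideanSpace ℝ (Fin m)) : evl x (lin w) = ⟪w, x⟫ := by
  simp [evl, lin, PiLp.inner_apply, mul_comm]

lemma evl_r2 {m : ℕ} (x : EuclideanSpace ℝ (Fin m)) (hx : ‖x‖ = 1) : evl x (r2 m) = 1 := by
  have h := EuclideanSpace.real_norm_sq_eq x
  rw [hx] at h
  simp only [evl, r2, map_sum, map_mul, MvPolynomial.aeval_X, ← pow_two, map_pow] at h ⊢
  rw [← h]; norm_num

lemma evl_dd {m k : ℕ} (w : EuclideanSpace ℝ (Fin m)) {p : MP m} (hp : p.IsHomogeneous k) :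
    evl w (dd w p) = k * evl w p := by
  have e := congrArg (evl w) hp.sum_X_mul_pderiv
  rw [dd_apply]
  simp only [map_sum, map_mul, map_smul, map_nsmul, nsmul_eq_mul, map_natCast] at e ⊢
  rw [← e]
  simp [evl]

/-- commuting -/
lemma lap_dd {m : ℕ} (w : EuclideanSpace ℝ (Fin m)) (p : MP m) :
    lap m (dd w p) = dd w (lap m p) := by
  have hc : ∀ (i j : Fin m) (q : MP m), MvPolynomial.pderiv i (MvPolynomial.pderiv j q) =
      MvPolynomial.pderiv j (MvPolynomial.pderiv i q) := by
    intro i j q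
    have : ⁅(MvPolynomial.pderiv i : Derivation ℝ (MP m) (MP m)), (MvPolynomial.pderiv j : Derivation ℝ (MP m) (MP m))⁆ = 0 := by
      apply MvPolynomial.derivation_ext
      intro l
      rw [Derivation.commutator_apply, MvPolynomial.pderiv_X, MvPolynomial.pderiv_X,
        Pi.single_apply, Pi.single_apply]
      split_ifs <;> simp
    have h2 := congrArg (fun D => D q) this
    simp only [Derivation.commutator_apply, Derivation.zero_apply] at h2
    exact sub_eq_zero.mp h2
  simp only [lap_apply_s12, dd_apply, map_sum, Derivation.map_smul, Finset.smul_sum]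
  rw [Finset.sum_comm]
  refine Finset.sum_congr rfl fun i _ => Finset.sum_congr rfl fun j _ => ?_
  rw [hc i j p, hc i j]

/-- Zonal polynomials. -/
noncomputable def zon {m : ℕ} (w : EuclideanSpace ℝ (Fin m)) : ℕ → MP m
  | 0 => 1
  | 1 => (m : ℝ) • lin w
  | (k + 2) => (lamG m (k + 2))⁻¹ •
      (lin w * zon w (k + 1) - (1 - lamG m k) • (r2 m * zon w k))

lemma lamG_zero (m : ℕ) : lamG m 0 = 0 := by simp [lamG]

lemma lamG_pos {m : ℕ} (hm : 1 ≤ m) (k : ℕ) : 0 < lamG m (k + 1) := by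
  have : (1:ℝ) ≤ m := by exact_mod_cast hm
  unfold lamG
  push_cast
  apply div_pos
  · positivity
  · have : (0:ℝ) ≤ k := by positivity
    linarith

lemma lin_mul_zon {m : ℕ} (hm : 1 ≤ m) (w : EuclideanSpace ℝ (Fin m)) (k : ℕ) :
    lin w * zon w (k + 1) =
      lamG m (k + 2) • zon w (k + 2) + (1 - lamG m k) • (r2 m * zon w k) := by
  have h := (lamG_pos hm (k + 1)).ne'
  rw [zon, smul_smul, mul_inv_cancel₀ h, one_smul]
  abel

lemma X_mul_geg {m : ℕ} (hm : 1 ≤ m) (k : ℕ) :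
    Polynomial.X * geg m (k + 1) =
      lamG m (k + 2) • geg m (k + 2) + (1 - lamG m k) • geg m k := by
  have h := (lamG_pos hm (k + 1)).ne'
  rw [geg.eq_3, smul_smul, mul_inv_cancel₀ h, one_smul]
  abel

lemma evl_zon {m : ℕ} (w x : EuclideanSpace ℝ (Fin m)) (hx : ‖x‖ = 1) (k : ℕ) :
    evl x (zon w k) = (geg m k).eval ⟪w, x⟫ := by
  induction k using Nat.twoStepInduction with
  | zero => simp [zon, geg]
  | one => simp [zon, geg, evl_lin]
  | more k h1 h2 =>
    rw [zon, geg]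
    simp only [map_smul, map_sub, map_mul, h1, h2, evl_lin, evl_r2 x hx, Polynomial.eval_smul,
      Polynomial.eval_sub, Polynomial.eval_mul, Polynomial.eval_X, one_mul]

lemma smul_hom {m k : ℕ} {p : MP m} (c : ℝ) (hp : p.IsHomogeneous k) :
    (c • p).IsHomogeneous k := by
  rw [MvPolynomial.smul_eq_C_mul]; exact hp.C_mul _

lemma zon_hom {m : ℕ} (w : EuclideanSpace ℝ (Fin m)) (k : ℕ) : (zon w k).IsHomogeneous k := by
  induction k using Nat.twoStepInduction with
  | zero => exact MvPolynomial.isHomogeneous_one _ _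
  | one => exact smul_hom _ (lin_hom w)
  | more k h1 h2 =>
    rw [zon]
    refine smul_hom _ (MvPolynomial.IsHomogeneous.sub ?_ (smul_hom _ ?_))
    · have := (lin_hom w).mul h2
      rwa [show 1 + (k + 1) = k + 2 by ring] at this
    · have := (r2_hom m).mul h1
      rwa [show 2 + k = k + 2 by ring] at this

lemma dd_zon {m : ℕ} (hm : 1 ≤ m) (w : EuclideanSpace ℝ (Fin m)) (hw : ‖w‖ = 1) (k : ℕ) :
    dd w (zon w (k + 1)) = ((1 - lamG m k) * (m + 2 * k)) • zon w k := by
  have hm' : (1:ℝ) ≤ m := by exact_mod_cast hm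
  induction k using Nat.twoStepInduction with
  | zero => simp [zon, lamG_zero, dd_lin w hw]
  | one =>
    rw [zon]
    simp only [zon, lamG_zero, Derivation.map_smul, map_sub, Derivation.leibniz, dd_lin w hw, dd_r2,
      smul_eq_mul, mul_one, sub_zero, one_smul, Derivation.map_one_eq_zero, zero_add, mul_zero]
    simp only [MvPolynomial.smul_eq_C_mul, mul_one]
    have : lamG m 2 = 2 / (m + 2) := by unfold lamG; norm_num; ring
    have h1 : lamG m 1 = 1 / m := by unfold lamG; norm_num
    rw [this, h1]
    have e : MvPolynomial.C ((1 - 1 / (m:ℝ)) * (m + 2 * ((1:ℕ):ℝ))) * (MvPolynomial.C (m:ℝ) * lin w)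
       = MvPolynomial.C ((2 / ((m:ℝ) + 2))⁻¹ * (2 * m - 2)) * lin w := by
      rw [← mul_assoc, ← MvPolynomial.C_mul]
      congr 2
      field_simp
      push_cast
      ring
    rw [e]
    simp only [MvPolynomial.C_mul, MvPolynomial.C_sub]
    have c2 : (MvPolynomial.C (2:ℝ) : MP m) = 2 := map_ofNat MvPolynomial.C 2
    rw [c2]
    ring
  | more k h1 h2 =>
    have hr := lin_mul_zon hm w k
    have hk : (0:ℝ) ≤ k := by positivity
    rw [zon]
    simp only [Derivation.map_smul, map_sub, Derivation.leibniz, dd_lin w hw, dd_r2,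
      smul_eq_mul, mul_one, h1]
    rw [show k + 1 + 1 = k + 2 from rfl] at *
    rw [h2]
    have e1 : zon w (k+1) * (2:ℝ) • lin w = (2:ℝ) • (lin w * zon w (k+1)) := by
      rw [mul_smul_comm, mul_comm]
    have e2 : lin w * ((1 - lamG m (k + 1)) * (↑m + 2 * ((k + 1 : ℕ):ℝ))) • zon w (k + 1) =
       ((1 - lamG m (k + 1)) * (↑m + 2 * ((k + 1 : ℕ):ℝ))) • (lin w * zon w (k+1)) := by
      rw [mul_smul_comm]
    rw [e1, e2, hr, mul_smul_comm]
    have a1 : lamG m (k+3) = (k+3)/(m + 2 * k + 4) := by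
      unfold lamG; push_cast; congr 1; ring
    have a2 : lamG m (k+2) = (k+2)/(m + 2 * k + 2) := by
      unfold lamG; push_cast; congr 1; ring
    have a3 : lamG m (k+1) = (k+1)/(m + 2 * k) := by
      unfold lamG; push_cast; congr 1; ring
    rw [show k + 1 + 2 = k + 3 from rfl, a1, a2, a3]
    have p1 : (m:ℝ) + 2 * k + 4 ≠ 0 := by positivity
    have p2 : (m:ℝ) + 2 * k + 2 ≠ 0 := by positivity
    have p3 : (m:ℝ) + 2 * k ≠ 0 := by positivity
    have p4 : (k:ℝ) + 3 ≠ 0 := by positivity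
    generalize lamG m k = L
    generalize zon w (k+2) = Z2
    generalize r2 m * zon w k = Z0
    push_cast
    match_scalars
    · field_simp
      ring
    · field_simp
      ring

lemma lap_zon {m : ℕ} (hm : 1 ≤ m) (w : EuclideanSpace ℝ (Fin m)) (hw : ‖w‖ = 1) (k : ℕ) :
    lap m (zon w k) = 0 := by
  induction k using Nat.twoStepInduction with
  | zero =>
    rw [zon, lap_apply_s12]; simp
  | one =>
    rw [zon, lap_apply_s12]
    simp [pderiv_lin]
  | more k h1 h2 =>
    rw [zon]
    simp only [map_smul, map_sub, lap_lin_mul, lap_r2_mul _ (zon_hom w k), h1, h2,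
      dd_zon hm w hw, mul_zero, zero_add, smul_smul]
    rw [← sub_smul]
    convert smul_zero _
    convert zero_smul ℝ _
    ring

/-- The bilinear Fischer pairing. -/
noncomputable def fis (m : ℕ) : MP m →ₗ[ℝ] MP m →ₗ[ℝ] ℝ :=
  (MvPolynomial.basisMonomials (Fin m) ℝ).constr ℝ
    (fun a => ((∏ i, (a i).factorial : ℕ) : ℝ) • MvPolynomial.lcoeff ℝ a)

lemma fis_mono {m : ℕ} (a : Fin m →₀ ℕ) (c : ℝ) (q : MP m) :
    fis m (MvPolynomial.monomial a c) q =
      c * ((∏ i, (a i).factorial : ℕ) : ℝ) * MvPolynomial.coeff a q := by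
  have h : MvPolynomial.monomial a c = c • (MvPolynomial.basisMonomials (Fin m) ℝ) a := by
    simp [MvPolynomial.smul_monomial]
  rw [h, map_smul, fis, Module.Basis.constr_basis]
  simp [mul_assoc]

lemma fis_self {m : ℕ} (p : MP m) :
    fis m p p = ∑ a ∈ p.support, ((∏ i, (a i).factorial : ℕ) : ℝ) * (p.coeff a)^2 := by
  conv_lhs => 
    enter [1]
    rw [p.as_sum]
  rw [map_sum, LinearMap.sum_apply]
  refine Finset.sum_congr rfl fun a _ => ?_
  rw [fis_mono]; ring

lemma fis_self_eq_zero {m : ℕ} {p : MP m} (h : fis m p p = 0) : p = 0 := by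
  rw [fis_self, Finset.sum_eq_zero_iff_of_nonneg (fun a _ => by positivity)] at h
  ext a
  by_contra hne
  have := h a (by simpa using hne)
  have hf : ((∏ i, (a i).factorial : ℕ) : ℝ) ≠ 0 := by
    exact_mod_cast (Finset.prod_pos fun i _ => Nat.factorial_pos _).ne'
  simp only [MvPolynomial.coeff_zero] at hne
  exact (mul_ne_zero hf (pow_ne_zero 2 hne)) this

lemma fis_X_mul {m : ℕ} (i : Fin m) (p q : MP m) :
    fis m (MvPolynomial.X i * p) q = fis m p (MvPolynomial.pderiv i q) := by
  induction p using MvPolynomial.induction_on' with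
  | add p1 p2 h1 h2 => simp [mul_add, h1, h2]
  | monomial a c =>
    rw [mul_comm, MvPolynomial.X, MvPolynomial.monomial_mul, fis_mono, fis_mono,
      MvPolynomial.coeff_pderiv]
    have : (∏ j, ((a + Finsupp.single i 1 : Fin m →₀ ℕ) j).factorial) = (a i + 1) * ∏ j, (a j).factorial := by
      rw [← Finset.mul_prod_erase _ _ (Finset.mem_univ i),
        ← Finset.mul_prod_erase _ (fun j => (a j).factorial) (Finset.mem_univ i)]
      have : ∏ x ∈ Finset.univ.erase i, ((a + Finsupp.single i 1 : Fin m →₀ ℕ) x).factorial =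
          ∏ x ∈ Finset.univ.erase i, (a x).factorial := by
        refine Finset.prod_congr rfl fun j hj => ?_
        have : j ≠ i := Finset.ne_of_mem_erase hj
        simp [Finsupp.single_apply, this.symm]
      rw [this]
      simp [Nat.factorial_succ, mul_assoc]
    rw [this]
    push_cast
    ring

lemma fis_lin_mul {m : ℕ} (w : EuclideanSpace ℝ (Fin m)) (p q : MP m) :
    fis m (lin w * p) q = fis m p (dd w q) := by
  rw [lin, dd_apply, Finset.sum_mul, map_sum, map_sum, LinearMap.sum_apply]
  refine Finset.sum_congr rfl fun i _ => ?_
  rw [smul_mul_assoc, map_smul, map_smul, LinearMap.smul_apply, fis_X_mul]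

lemma fis_r2_mul {m : ℕ} (p q : MP m) :
    fis m (r2 m * p) q = fis m p (lap m q) := by
  rw [r2, lap_apply_s12, Finset.sum_mul, map_sum, map_sum, LinearMap.sum_apply]
  refine Finset.sum_congr rfl fun i _ => ?_
  rw [mul_assoc, fis_X_mul, fis_X_mul]

/-- Harmonic homogeneous polynomials. -/
noncomputable def harm (m k : ℕ) : Submodule ℝ (MP m) :=
  MvPolynomial.homogeneousSubmodule (Fin m) ℝ k ⊓ LinearMap.ker (lap m)

lemma mem_harm {m k : ℕ} {p : MP m} : p ∈ harm m k ↔ p.IsHomogeneous k ∧ lap m p = 0 := by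
  simp [harm]

lemma zon_mem {m : ℕ} (hm : 1 ≤ m) (w : EuclideanSpace ℝ (Fin m)) (hw : ‖w‖ = 1) (k : ℕ) :
    zon w k ∈ harm m k := mem_harm.2 ⟨zon_hom w k, lap_zon hm w hw k⟩

lemma dd_mem {m k : ℕ} (w : EuclideanSpace ℝ (Fin m)) {p : MP m} (hp : p ∈ harm m k) :
    dd w p ∈ harm m (k - 1) := by
  rw [mem_harm] at *
  exact ⟨dd_hom w hp.1, by rw [lap_dd, hp.2, map_zero]⟩

lemma fis_zon {m : ℕ} (hm : 1 ≤ m) (k : ℕ) :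
    ∃ c : ℝ, 0 < c ∧ ∀ w : EuclideanSpace ℝ (Fin m), ∀ p ∈ harm m k,
      fis m (zon w k) p = c * evl w p := by
  induction k using Nat.twoStepInduction with
  | zero =>
    refine ⟨1, one_pos, fun w p hp => ?_⟩
    have hp := (mem_harm.1 hp).1
    rw [← MvPolynomial.totalDegree_zero_iff_isHomogeneous,
      MvPolynomial.totalDegree_eq_zero_iff_eq_C] at hp
    rw [hp, zon, ← MvPolynomial.C_1, MvPolynomial.C_apply, fis_mono]
    simp [evl]
  | one => 
    refine ⟨m, by exact_mod_cast hm, fun w p hp => ?_⟩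
    have h0 := (mem_harm.1 (dd_mem w hp)).1
    have e := evl_dd w (mem_harm.1 hp).1
    rw [zon, ← mul_one (lin w), ← smul_mul_assoc, smul_mul_assoc, map_smul, LinearMap.smul_apply,
      fis_lin_mul]
    rw [← MvPolynomial.totalDegree_zero_iff_isHomogeneous,
      MvPolynomial.totalDegree_eq_zero_iff_eq_C] at h0
    rw [h0] at e ⊢
    rw [← MvPolynomial.C_1, MvPolynomial.C_apply, fis_mono]
    simp [evl] at e ⊢
    left
    rw [e]
  | more k h1 h2 =>
    obtain ⟨c, hc, h2⟩ := h2
    refine ⟨(lamG m (k+2))⁻¹ * (c * (k + 2)),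
      mul_pos (inv_pos.2 (lamG_pos hm (k+1))) (by positivity), fun w p hp => ?_⟩
    rw [zon, map_smul, LinearMap.smul_apply, map_sub, LinearMap.sub_apply, map_smul,
      LinearMap.smul_apply, fis_lin_mul, fis_r2_mul, (mem_harm.1 hp).2, map_zero, smul_zero, sub_zero,
      h2 w _ (dd_mem w hp), evl_dd w (mem_harm.1 hp).1, smul_eq_mul]
    push_cast
    ring

lemma sum_harm {m j : ℕ} (hm : 1 ≤ m) (X : Finset (EuclideanSpace ℝ (Fin m)))
    (hX : ∀ x ∈ X, ‖x‖ = 1) (h : ∑ x ∈ X, ∑ y ∈ X, (geg m j).eval ⟪x, y⟫ = 0)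
    (p : MP m) (hp : p ∈ harm m j) : ∑ x ∈ X, evl x p = 0 := by
  obtain ⟨c, hc, hf⟩ := fis_zon hm j
  set S : MP m := ∑ x ∈ X, zon x j with hS
  have hSm : S ∈ harm m j := Submodule.sum_mem _ fun x hx => zon_mem hm x (hX x hx) j
  have key : ∀ q ∈ harm m j, fis m S q = c * ∑ x ∈ X, evl x q := by
    intro q hq
    rw [hS, map_sum, LinearMap.sum_apply, Finset.mul_sum]
    exact Finset.sum_congr rfl fun x _ => hf x q hq
  have h0 : fis m S S = 0 := by
    rw [key S hSm]
    simp only [hS, map_sum]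
    rw [Finset.sum_comm]
    have : ∑ y ∈ X, ∑ x ∈ X, evl x (zon y j) = 0 := by
      rw [← h]
      refine Finset.sum_congr rfl fun y _ => Finset.sum_congr rfl fun x hx => ?_
      exact evl_zon y x (hX x hx) j
    rw [this, mul_zero]
  have hS0 := fis_self_eq_zero h0
  have := key p hp
  rw [hS0] at this
  simp at this
  exact this.resolve_left hc.ne'

lemma dd_eq_zero {m : ℕ} (w : EuclideanSpace ℝ (Fin m)) {p : MP m} (hp : p ∈ harm m 0) :
    dd w p = 0 := by
  have hp := (mem_harm.1 hp).1
  rw [← MvPolynomial.totalDegree_zero_iff_isHomogeneous,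
      MvPolynomial.totalDegree_eq_zero_iff_eq_C] at hp
  rw [hp, dd_apply]; simp

lemma harm_plus {m k : ℕ} (hm : 1 ≤ m) (w : EuclideanSpace ℝ (Fin m)) {p : MP m}
    (hp : p ∈ harm m k) :
    lin w * p - ((m:ℝ) + 2 * k - 2)⁻¹ • (r2 m * dd w p) ∈ harm m (k + 1) := by
  have hp' := mem_harm.1 hp
  rw [mem_harm]
  rcases k with _ | k
  · rw [dd_eq_zero w hp]
    simp only [mul_zero, smul_zero, sub_zero]
    refine ⟨?_, ?_⟩
    · have := (lin_hom w).mul hp'.1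
      rwa [add_comm] at this
    · rw [lap_lin_mul, hp'.2, dd_eq_zero w hp]; simp
  · have hd := mem_harm.1 (dd_mem w hp)
    simp only [Nat.add_sub_cancel] at hd
    refine ⟨MvPolynomial.IsHomogeneous.sub ?_ (smul_hom _ ?_), ?_⟩
    · have := (lin_hom w).mul hp'.1
      rwa [add_comm] at this
    · have := (r2_hom m).mul hd.1
      rwa [show 2 + k = k + 1 + 1 by ring] at this
    · rw [map_sub, map_smul, lap_lin_mul, lap_r2_mul _ hd.1, hp'.2, hd.2]
      simp only [mul_zero, zero_add, smul_smul]
      rw [← sub_smul]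
      convert zero_smul ℝ _
      have : (m:ℝ) + 2 * k ≠ 0 := by
        have : (1:ℝ) ≤ m := by exact_mod_cast hm
        positivity
      push_cast
      rw [show (m:ℝ) + 2 * (k + 1) - 2 = m + 2 * k by ring]
      field_simp
      ring

lemma repro {m t : ℕ} (hm : 1 ≤ m) (X : Finset (EuclideanSpace ℝ (Fin m)))
    (hX : ∀ x ∈ X, ‖x‖ = 1) (hd : IsGegDesign m t X)
    (w : EuclideanSpace ℝ (Fin m)) (hw : ‖w‖ = 1) (l : ℕ) :
    ∀ k (p : MP m), p ∈ harm m k → k + l ≤ t →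
      ∑ x ∈ X, evl x p * evl x (zon w l) = if k = l then (X.card : ℝ) * evl w p else 0 := by
  have hm' : (1:ℝ) ≤ m := by exact_mod_cast hm
  have hT : ∀ k (p : MP m), p ∈ harm m k → k ≤ t →
      ∑ x ∈ X, evl x p = if k = 0 then (X.card : ℝ) * evl w p else 0 := by
    intro k p hp hk
    split_ifs with h0
    · subst h0
      have hp := (mem_harm.1 hp).1
      rw [← MvPolynomial.totalDegree_zero_iff_isHomogeneous,
        MvPolynomial.totalDegree_eq_zero_iff_eq_C] at hp
      rw [hp]; simp [evl]
    · exact sum_harm hm X hX (hd k (by omega) hk) p hp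
  -- multiplication by the linear form
  have hL : ∀ k (p : MP m) (q : MP m), 
      ∑ x ∈ X, evl x p * evl x (lin w * q) =
        ∑ x ∈ X, evl x (lin w * p - ((m:ℝ) + 2 * k - 2)⁻¹ • (r2 m * dd w p)) * evl x q +
        ((m:ℝ) + 2 * k - 2)⁻¹ * ∑ x ∈ X, evl x (dd w p) * evl x q := by
    intro k p q
    rw [Finset.mul_sum, ← Finset.sum_add_distrib]
    refine Finset.sum_congr rfl fun x hx => ?_
    simp only [map_sub, map_mul, map_smul, evl_r2 x (hX x hx), smul_eq_mul]
    ring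
  have hP : ∀ k (p : MP m), p ∈ harm m k →
      evl w (lin w * p - ((m:ℝ) + 2 * k - 2)⁻¹ • (r2 m * dd w p)) = (1 - lamG m k) * evl w p := by
    intro k p hp
    simp only [map_sub, map_mul, map_smul, evl_r2 w hw, smul_eq_mul, evl_dd w (mem_harm.1 hp).1,
      evl_lin]
    rw [real_inner_self_eq_norm_sq, hw]
    unfold lamG
    ring
  induction l using Nat.twoStepInduction with
  | zero =>
    intro k p hp hk
    simpa [zon] using hT k p hp hk
  | one =>
    intro k p hp hk
    have h1 := hL k p 1
    simp only [mul_one, map_one] at h1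
    rw [hT (k+1) _ (harm_plus hm w hp) hk, if_neg (by omega), zero_add] at h1
    simp only [zon, map_smul, smul_eq_mul]
    simp only [mul_left_comm _ (m:ℝ)]
    rw [← Finset.mul_sum, h1]
    rcases k with _ | k
    · rw [dd_eq_zero w hp]; simp
    · rw [hT k _ (dd_mem w hp) (by omega), evl_dd w (mem_harm.1 hp).1]
      by_cases h : k = 0
      · subst h
        simp
        field_simp
      · simp [h]
  | more l h1 h2 =>
    intro k p hp hk
    have e : ∑ x ∈ X, evl x p * evl x (zon w (l+2)) = (lamG m (l+2))⁻¹ *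
        (∑ x ∈ X, evl x p * evl x (lin w * zon w (l+1)) -
          (1 - lamG m l) * ∑ x ∈ X, evl x p * evl x (zon w l)) := by
      rw [Finset.mul_sum, ← Finset.sum_sub_distrib, Finset.mul_sum]
      refine Finset.sum_congr rfl fun x hx => ?_
      rw [zon]
      simp only [map_sub, map_mul, map_smul, evl_r2 x (hX x hx), smul_eq_mul]
      ring
    rw [e, hL k p, h2 _ _ (harm_plus hm w hp) (by omega), hP k p hp, h1 k p hp (by omega)]
    rcases k with _ | k
    · rw [dd_eq_zero w hp]
      by_cases h : l = 0
      · subst h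
        have e0 : ∀ a b c : ℝ, a * (b * c) - b * (a * c) = 0 := fun a b c => by ring
        simp [e0]
      · have : ¬ (0 = l) := fun h' => h h'.symm
        simp [h, this]
    · rw [h2 _ _ (dd_mem w hp) (by omega), evl_dd w (mem_harm.1 hp).1]
      by_cases ha : k + 1 = l
      · subst ha
        rw [if_pos rfl, if_pos rfl, if_neg (by omega), if_neg (by omega)]
        ring
      · by_cases hb : k = l + 1
        · subst hb
          rw [if_neg (show ¬ (l + 1 + 1 + 1 = l + 1) by omega), if_pos (show l + 1 + 1 - 1 = l + 1 by omega),
            if_neg (show ¬ (l + 1 + 1 = l) by omega), if_pos rfl]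
          have : (m:ℝ) + 2 * l + 2 ≠ 0 := by positivity
          unfold lamG
          push_cast
          rw [show (m:ℝ) + 2 * (l + 1 + 1) - 2 = m + 2 * l + 2 by ring,
            show (m:ℝ) + 2 * (l + 2) - 2 = m + 2 * l + 2 by ring]
          have : (l:ℝ) + 2 ≠ 0 := by positivity
          field_simp
          ring
        · simp [ha, hb]

lemma finrank_hom (m k : ℕ) : Module.finrank ℝ (MvPolynomial.homogeneousSubmodule (Fin m) ℝ k) =
    (m + k - 1).choose k := by
  have h1 : MvPolynomial.homogeneousSubmodule (Fin m) ℝ k =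
      Submodule.span ℝ (((Finset.finsuppAntidiag (Finset.univ : Finset (Fin m)) k).image
        (fun a => (MvPolynomial.basisMonomials (Fin m) ℝ) a) : Finset (MP m)) : Set (MP m)) := by
    apply le_antisymm
    · intro p hp
      rw [p.as_sum]
      refine Submodule.sum_mem _ fun a ha => ?_
      have : MvPolynomial.monomial a (p.coeff a) =
          p.coeff a • (MvPolynomial.basisMonomials (Fin m) ℝ) a := by
        simp [MvPolynomial.smul_monomial]
      rw [this]
      refine Submodule.smul_mem _ _ (Submodule.subset_span ?_)
      simp only [Finset.coe_image, Set.mem_image, Finset.mem_coe]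
      refine ⟨a, ?_, rfl⟩
      rw [Finset.mem_finsuppAntidiag]
      refine ⟨?_, Finset.subset_univ _⟩
      have := MvPolynomial.IsHomogeneous.degree_eq_sum_deg_support hp ha
      rw [this]
      exact (Finset.sum_subset (Finset.subset_univ _) (fun i _ hi => by simpa using hi)).symm
    · rw [Submodule.span_le]
      intro p hp
      simp only [Finset.coe_image, Set.mem_image, Finset.mem_coe, Finset.mem_finsuppAntidiag] at hp
      obtain ⟨a, ⟨ha, _⟩, rfl⟩ := hp
      simp only [MvPolynomial.coe_basisMonomials]
      apply MvPolynomial.isHomogeneous_monomial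
      rw [Finsupp.degree_eq_sum, ha]
  have hli := (MvPolynomial.basisMonomials (Fin m) ℝ).linearIndependent
  rw [h1, finrank_span_finset_eq_card]
  · rw [Finset.card_image_of_injective _ hli.injective,
      Finset.card_finsuppAntidiag_nat_eq_choose]
    simp
  · have := hli.linearIndepOn_id
    refine this.mono ?_
    intro p hp
    simp only [Finset.coe_image, Set.mem_image, Finset.mem_coe] at hp
    obtain ⟨a, _, rfl⟩ := hp
    exact ⟨a, rfl⟩

instance (m k : ℕ) : FiniteDimensional ℝ (MvPolynomial.homogeneousSubmodule (Fin m) ℝ k) :=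
  Module.Finite.iff_fg.2 (MvPolynomial.homogeneousSubmodule_fg _ _ k)

instance (m k : ℕ) : FiniteDimensional ℝ (harm m k) :=
  Submodule.finiteDimensional_of_le (inf_le_left :
    harm m k ≤ MvPolynomial.homogeneousSubmodule (Fin m) ℝ k)

lemma finrank_harm {m k : ℕ} (hm : 1 ≤ m) : Module.finrank ℝ (harm m k) ≤ hdim m k := by
  have hle : harm m k ≤ MvPolynomial.homogeneousSubmodule (Fin m) ℝ k := inf_le_left
  unfold hdim
  split_ifs with hk
  · have hr : r2 m ≠ 0 := by
      intro h0
      have := evl_r2 (EuclideanSpace.single (⟨0, hm⟩ : Fin m) (1:ℝ)) (by simp)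
      rw [h0] at this
      simp at this
    set R := (MvPolynomial.homogeneousSubmodule (Fin m) ℝ (k-2)).map
      (LinearMap.mulLeft ℝ (r2 m)) with hR
    have hRle : R ≤ MvPolynomial.homogeneousSubmodule (Fin m) ℝ k := by
      rintro _ ⟨q, hq, rfl⟩
      have := (r2_hom m).mul hq
      rw [show 2 + (k - 2) = k by omega] at this
      exact this
    have hRd : Module.finrank ℝ R = (m + k - 3).choose (k - 2) := by
      have hinj : Function.Injective (LinearMap.mulLeft ℝ (r2 m)) := by
        intro a b hab
        exact mul_left_cancel₀ hr hab
      rw [hR, ← (Submodule.equivMapOfInjective _ hinj _).finrank_eq, finrank_hom]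
      congr 1
      omega
    have hdis : harm m k ⊓ R = ⊥ := by
      rw [eq_bot_iff]
      rintro p ⟨hp, ⟨q, hq, rfl⟩⟩
      have h2 := (mem_harm.1 hp).2
      simp only [LinearMap.mulLeft_apply] at h2 ⊢
      rw [Submodule.mem_bot]
      apply fis_self_eq_zero
      rw [fis_r2_mul, h2, map_zero]
    have : FiniteDimensional ℝ R := Submodule.finiteDimensional_of_le hRle
    have h1 := Submodule.finrank_sup_add_finrank_inf_eq (harm m k) R
    rw [hdis, finrank_bot, hRd, add_zero] at h1
    have h2 := Submodule.finrank_mono (sup_le hle hRle)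
    rw [finrank_hom] at h2
    omega
  · have := Submodule.finrank_mono hle
    rw [finrank_hom] at this
    simpa using this

lemma geg_deg {m : ℕ} (hm : 1 ≤ m) (k : ℕ) :
    (geg m k).natDegree ≤ k ∧ (geg m k).coeff k ≠ 0 := by
  induction k using Nat.twoStepInduction with
  | zero => simp [geg]
  | one =>
    refine ⟨?_, ?_⟩
    · rw [geg]
      exact (Polynomial.natDegree_C_mul_le _ _).trans Polynomial.natDegree_X_le
    · rw [geg]
      simp
      omega
  | more k h1 h2 =>
    rw [geg]
    refine ⟨?_, ?_⟩
    · refine (Polynomial.natDegree_smul_le _ _).trans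
        ((Polynomial.natDegree_sub_le _ _).trans (max_le ?_ ?_))
      · refine Polynomial.natDegree_mul_le.trans ?_
        have := @Polynomial.natDegree_X_le ℝ _
        omega
      · exact (Polynomial.natDegree_smul_le _ _).trans (by omega)
    · have h3 : (geg m k).coeff (k + 2) = 0 :=
        Polynomial.coeff_eq_zero_of_natDegree_lt (by omega)
      rw [Polynomial.coeff_smul, Polynomial.coeff_sub, Polynomial.coeff_smul, h3, smul_zero,
        sub_zero, Polynomial.coeff_X_mul]
      exact mul_ne_zero (inv_ne_zero (lamG_pos hm (k+1)).ne') h2.2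

lemma geg_expand {m : ℕ} (hm : 1 ≤ m) (s : ℕ) : ∀ P : Polynomial ℝ, P.natDegree ≤ s →
    ∃ f : ℕ → ℝ, P = ∑ j ∈ Finset.range (s + 1), f j • geg m j ∧ (P.coeff s ≠ 0 → f s ≠ 0) := by
  induction s with
  | zero =>
    intro P hP
    refine ⟨fun _ => P.coeff 0, ?_, fun h => h⟩
    rw [Polynomial.eq_C_of_natDegree_le_zero hP]
    simp [geg, Polynomial.smul_eq_C_mul]
  | succ s ih =>
    intro P hP
    obtain ⟨hd, hc⟩ := geg_deg hm (s+1)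
    set c := P.coeff (s+1) / (geg m (s+1)).coeff (s+1) with hcdef
    have hQ : (P - c • geg m (s+1)).natDegree ≤ s := by
      rw [Polynomial.natDegree_le_iff_coeff_eq_zero]
      intro N hN
      rcases Nat.eq_or_lt_of_le (Nat.succ_le_of_lt hN) with h | h
      · rw [← h]
        simp only [Nat.succ_eq_add_one, Polynomial.coeff_sub, Polynomial.coeff_smul, smul_eq_mul,
          hcdef]
        field_simp
        simp
      · rw [Polynomial.coeff_sub, Polynomial.coeff_smul,
          Polynomial.coeff_eq_zero_of_natDegree_lt (by omega : P.natDegree < N),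
          Polynomial.coeff_eq_zero_of_natDegree_lt (by omega : (geg m (s+1)).natDegree < N)]
        simp
    obtain ⟨f, hf, _⟩ := ih _ hQ
    refine ⟨fun j => if j = s + 1 then c else f j, ?_, ?_⟩
    · rw [Finset.sum_range_succ]
      have : ∑ j ∈ Finset.range (s + 1), (if j = s + 1 then c else f j) • geg m j =
          ∑ j ∈ Finset.range (s + 1), f j • geg m j := by
        refine Finset.sum_congr rfl fun j hj => ?_
        rw [Finset.mem_range] at hj
        rw [if_neg (by omega)]
      rw [this, ← hf]
      simp
    · intro h
      simp only [if_true]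
      exact div_ne_zero h hc

lemma geg_mul {m t : ℕ} (hm : 1 ≤ m) (Φ : Polynomial ℝ →ₗ[ℝ] ℝ)
    (h0 : ∀ j, 1 ≤ j → j ≤ t → Φ (geg m j) = 0) (k : ℕ) :
    ∀ l, k < l → k + l ≤ t + 1 → ∃ c : ℝ, c ≠ 0 ∧ Φ (geg m k * geg m l) = c * Φ (geg m (k + l)) := by
  have hm' : (1:ℝ) ≤ m := by exact_mod_cast hm
  induction k using Nat.twoStepInduction with
  | zero => 
    intro l _ _
    exact ⟨1, one_ne_zero, by simp [geg]⟩
  | one =>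
    intro l hl hlt
    obtain ⟨l, rfl⟩ : ∃ l', l = l' + 1 := ⟨l - 1, by omega⟩
    refine ⟨m * lamG m (l+2), mul_ne_zero (by positivity) (lamG_pos hm (l+1)).ne', ?_⟩
    rw [show geg m 1 = Polynomial.C (m:ℝ) * Polynomial.X from by rw [geg], mul_assoc,
      X_mul_geg hm, ← Polynomial.smul_eq_C_mul, map_smul, map_add, map_smul, map_smul,
      h0 l (by omega) (by omega), show 1 + (l + 1) = l + 2 by ring]
    simp [mul_assoc]
  | more k h1 h2 =>
    intro l hl hlt
    obtain ⟨l, rfl⟩ : ∃ l', l = l' + 1 := ⟨l - 1, by omega⟩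
    obtain ⟨c1, _, e1⟩ := h1 (l+1) (by omega) (by omega)
    obtain ⟨c2, _, e2⟩ := h2 l (by omega) (by omega)
    obtain ⟨c3, hc3, e3⟩ := h2 (l+2) (by omega) (by omega)
    rw [h0 _ (by omega) (by omega), mul_zero] at e1 e2
    refine ⟨(lamG m (k+2))⁻¹ * lamG m (l+2) * c3, mul_ne_zero (mul_ne_zero
      (inv_ne_zero (lamG_pos hm (k+1)).ne') (lamG_pos hm (l+1)).ne') hc3, ?_⟩
    have : geg m (k+2) * geg m (l+1) = (lamG m (k+2))⁻¹ •
       (lamG m (l+2) • (geg m (k+1) * geg m (l+2)) + (1 - lamG m l) • (geg m (k+1) * geg m l)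
         - (1 - lamG m k) • (geg m k * geg m (l+1))) := by
      rw [← mul_smul_comm, ← mul_smul_comm, ← mul_add, ← X_mul_geg hm l]
      rw [geg.eq_3, smul_mul_assoc, sub_mul, smul_mul_assoc]
      congr 2
      ring
    rw [this, map_smul, map_sub, map_add, map_smul, map_smul, map_smul, e1, e2, e3,
      show k + 1 + (l + 2) = k + 2 + (l + 1) by ring]
    simp [mul_assoc]

lemma finrank_sum_le {ι V : Type*} [AddCommGroup V] [Module ℝ V] [FiniteDimensional ℝ V]
    (T : Finset ι) (U : ι → Submodule ℝ V) :
    Module.finrank ℝ (T.sup U : Submodule ℝ V) ≤ ∑ j ∈ T, Module.finrank ℝ (U j) := by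
  induction T using Finset.induction_on with
  | empty => simp
  | insert a T ha ih =>
    rw [Finset.sup_insert, Finset.sum_insert ha]
    exact (Submodule.finrank_add_le_finrank_add_finrank _ _).trans (by omega)

/-- If `X ⊆ S^{m-1}` is an `s`-distance set with strength `2s - i`, `2 ≤ i ≤ s + 1`,
then `|X| ≤ ∑_{k=0}^s h_k - h_{s-i+1}`. -/
theorem card_le_of_distance_set_strength (m s i : ℕ) (hi2 : 2 ≤ i) (his : i ≤ s + 1)
    (X : Finset (EuclideanSpace ℝ (Fin m))) (hX : ∀ x ∈ X, ‖x‖ = 1)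
    (hdist : (innerSet m X).card = s)
    (hdes : IsGegDesign m (2 * s - i) X)
    (hnot : ¬ IsGegDesign m (2 * s - i + 1) X) :
    X.card ≤ (∑ k ∈ Finset.range (s + 1), hdim m k) - hdim m (s + 1 - i) := by
  -- the case `m = 0` is void
  have hm : 1 ≤ m := by
    by_contra hm
    have hm0 : m = 0 := by omega
    subst hm0
    have : (innerSet 0 X) = ∅ := by
      unfold innerSet
      rw [Finset.image_eq_empty, Finset.filter_eq_empty_iff]
      intro p _ hp
      exact hp (Subsingleton.elim _ _)
    rw [this] at hdist
    simp at hdist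
    omega
  obtain ⟨k, hk⟩ : ∃ k, k = s + 1 - i := ⟨_, rfl⟩
  obtain ⟨t, ht⟩ : ∃ t, t = 2 * s - i := ⟨_, rfl⟩
  rw [← ht] at hdes hnot
  rw [← hk]
  have hks : k < s := by omega
  have hkst : k + s = t + 1 := by omega
  have hsum : ∑ k ∈ Finset.range (s + 1), hdim m k - hdim m k =
      ∑ j ∈ (Finset.range (s + 1)).erase k, hdim m j := by
    rw [← Finset.add_sum_erase _ _ (Finset.mem_range.2 (by omega : k < s + 1))]
    omega
  rw [hsum]
  -- the annihilator polynomial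
  set A := innerSet m X with hA
  have hA1 : ∀ a ∈ A, a ≠ 1 := by
    intro a ha
    simp only [hA, innerSet, Finset.mem_image, Finset.mem_filter, Finset.mem_product] at ha
    obtain ⟨p, ⟨⟨h1, h2⟩, hne⟩, rfl⟩ := ha
    intro h
    exact hne ((inner_eq_one_iff_of_norm_eq_one (hX _ h1) (hX _ h2)).1 h)
  set P0 : Polynomial ℝ := ∏ a ∈ A, (Polynomial.X - Polynomial.C a) with hP0
  have hP0m : P0.Monic := Polynomial.monic_prod_of_monic _ _ fun a _ => Polynomial.monic_X_sub_C a
  have hP0d : P0.natDegree = s := by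
    rw [hP0, Polynomial.natDegree_prod_of_monic _ _ fun a _ => Polynomial.monic_X_sub_C a]
    simp [hdist]
  have hP01 : P0.eval 1 ≠ 0 := by
    rw [hP0, Polynomial.eval_prod, Finset.prod_ne_zero_iff]
    intro a ha
    simp only [Polynomial.eval_sub, Polynomial.eval_X, Polynomial.eval_C]
    exact sub_ne_zero.2 (hA1 a ha).symm
  obtain ⟨f, hf, hfs⟩ := geg_expand hm s ((P0.eval 1)⁻¹ • P0)
    ((Polynomial.natDegree_smul_le _ _).trans hP0d.le)
  have hfs : f s ≠ 0 := by
    apply hfs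
    rw [Polynomial.coeff_smul]
    have : P0.coeff s = 1 := by
      have := hP0m.coeff_natDegree
      rwa [hP0d] at this
    rw [this]
    simpa using hP01
  have hdelta : ∀ x ∈ X, ∀ y ∈ X, ∑ j ∈ Finset.range (s + 1), f j * (geg m j).eval ⟪x, y⟫ =
      if x = y then 1 else 0 := by
    intro x hx y hy
    have h := congrArg (fun Q => Polynomial.eval ⟪x, y⟫ Q) hf
    simp only [Polynomial.eval_finsetSum, Polynomial.eval_smul, smul_eq_mul] at h
    rw [← h]
    split_ifs with hxy
    · subst hxy
      rw [real_inner_self_eq_norm_sq, hX x hx]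
      norm_num
      exact inv_mul_cancel₀ hP01
    · have : P0.eval ⟪x, y⟫ = 0 := by
        rw [hP0, Polynomial.eval_prod]
        refine Finset.prod_eq_zero (i := ⟪x, y⟫) ?_ (by simp)
        simp only [hA, innerSet, Finset.mem_image, Finset.mem_filter, Finset.mem_product]
        exact ⟨(x, y), ⟨⟨hx, hy⟩, hxy⟩, rfl⟩
      rw [this, mul_zero]
  have hrep : ∀ x ∈ X, ∀ y ∈ X, ∀ j, j + k ≤ t →
      ∑ z ∈ X, (geg m j).eval ⟪x, z⟫ * (geg m k).eval ⟪z, y⟫ =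
        if j = k then (X.card : ℝ) * (geg m k).eval ⟪x, y⟫ else 0 := by
    intro x hx y hy j hj
    have h := repro hm X hX hdes y (hX y hy) k j (zon x j) (zon_mem hm x (hX x hx) j) hj
    have e : ∑ z ∈ X, (geg m j).eval ⟪x, z⟫ * (geg m k).eval ⟪z, y⟫ =
        ∑ z ∈ X, evl z (zon x j) * evl z (zon y k) := by
      refine Finset.sum_congr rfl fun z hz => ?_
      rw [evl_zon _ _ (hX z hz), evl_zon _ _ (hX z hz), real_inner_comm y z]
    rw [e, h]
    split_ifs with hjk
    · rw [evl_zon _ _ (hX y hy), hjk]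
    · rfl
  have hmain : ∀ x ∈ X, ∀ y ∈ X, (1 - f k * X.card) * (geg m k).eval ⟪x, y⟫ =
      f s * ∑ z ∈ X, (geg m s).eval ⟪x, z⟫ * (geg m k).eval ⟪z, y⟫ := by
    intro x hx y hy
    have h1 : ∑ z ∈ X, (∑ j ∈ Finset.range (s + 1), f j * (geg m j).eval ⟪x, z⟫) *
        (geg m k).eval ⟪z, y⟫ = (geg m k).eval ⟪x, y⟫ := by
      rw [Finset.sum_congr rfl fun z hz => by rw [hdelta x hx z hz]]
      simp [hx]
    have h2 : ∑ z ∈ X, (∑ j ∈ Finset.range (s + 1), f j * (geg m j).eval ⟪x, z⟫) *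
        (geg m k).eval ⟪z, y⟫ = ∑ j ∈ Finset.range (s + 1), f j *
          ∑ z ∈ X, (geg m j).eval ⟪x, z⟫ * (geg m k).eval ⟪z, y⟫ := by
      simp only [Finset.sum_mul, Finset.mul_sum]
      rw [Finset.sum_comm]
      simp only [mul_assoc]
    rw [h2, Finset.sum_range_succ] at h1
    have h3 : ∑ j ∈ Finset.range s, f j *
          ∑ z ∈ X, (geg m j).eval ⟪x, z⟫ * (geg m k).eval ⟪z, y⟫ =
          f k * (X.card * (geg m k).eval ⟪x, y⟫) := by
      rw [Finset.sum_eq_single k]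
      · rw [hrep x hx y hy k (by omega), if_pos rfl]
      · intro j hj hjk
        rw [Finset.mem_range] at hj
        rw [hrep x hx y hy j (by omega), if_neg hjk, mul_zero]
      · intro h; exact absurd (Finset.mem_range.2 hks) h
    rw [h3] at h1
    linear_combination -h1
  by_cases hcase : 1 - f k * X.card = 0
  · -- contradiction with the strength
    exfalso
    have hz : ∀ x ∈ X, ∀ y ∈ X,
        ∑ z ∈ X, (geg m s).eval ⟪x, z⟫ * (geg m k).eval ⟪z, y⟫ = 0 := by
      intro x hx y hy
      have := hmain x hx y hy
      rw [hcase, zero_mul] at this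
      exact (mul_eq_zero.1 this.symm).resolve_left hfs
    let Φ : Polynomial ℝ →ₗ[ℝ] ℝ := ∑ x ∈ X, ∑ y ∈ X, Polynomial.leval ⟪x, y⟫
    have hΦ : ∀ Q, Φ Q = ∑ x ∈ X, ∑ y ∈ X, Q.eval ⟪x, y⟫ := by
      intro Q
      simp [Φ, LinearMap.sum_apply, Polynomial.leval]
    obtain ⟨c, hc, he⟩ := geg_mul hm Φ (t := t)
      (fun j h1 h2 => by rw [hΦ]; exact hdes j h1 h2) k s hks hkst.le
    have h0 : Φ (geg m k * geg m s) = 0 := by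
      rw [hΦ]
      refine Finset.sum_eq_zero fun x hx => ?_
      rw [← hz x hx x hx]
      refine Finset.sum_congr rfl fun y _ => ?_
      rw [Polynomial.eval_mul, mul_comm, real_inner_comm x y]
    rw [h0] at he
    have h1 : Φ (geg m (k + s)) = 0 := (mul_eq_zero.1 he.symm).resolve_left hc
    rw [hΦ, hkst] at h1
    apply hnot
    intro j hj1 hj2
    rcases Nat.lt_or_ge t j with h | h
    · have : j = t + 1 := by omega
      rw [this]; exact h1
    · exact hdes j hj1 h
  · -- dimension count
    let ev : MP m →ₗ[ℝ] (X → ℝ) := LinearMap.pi fun x => (evl x.1).toLinearMap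
    let U : ℕ → Submodule ℝ (X → ℝ) := fun j => (harm m j).map ev
    set T := (Finset.range (s + 1)).erase k with hT
    have hgU : ∀ j, ∀ y ∈ X, (fun x : X => (geg m j).eval ⟪(x:EuclideanSpace ℝ (Fin m)), y⟫) ∈ U j := by
      intro j y hy
      refine ⟨zon y j, zon_mem hm y (hX y hy) j, ?_⟩
      ext x
      simp only [ev, LinearMap.pi_apply, AlgHom.toLinearMap_apply]
      rw [evl_zon _ _ (hX x x.2), real_inner_comm]
    have hsT : s ∈ T := by
      rw [hT, Finset.mem_erase, Finset.mem_range]; omega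
    have hall : ∀ j ∈ Finset.range (s + 1), ∀ y ∈ X,
        (fun x : X => (geg m j).eval ⟪(x:EuclideanSpace ℝ (Fin m)), y⟫) ∈ T.sup U := by
      intro j hj y hy
      by_cases hjk : j = k
      · subst hjk
        have : (fun x : X => (geg m j).eval ⟪(x:EuclideanSpace ℝ (Fin m)), y⟫) =
            ∑ z ∈ X, ((1 - f j * X.card)⁻¹ * f s * (geg m j).eval ⟪z, y⟫) •
              (fun x : X => (geg m s).eval ⟪(x:EuclideanSpace ℝ (Fin m)), z⟫) := by
          ext x
          rw [Finset.sum_apply]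
          simp only [Pi.smul_apply, smul_eq_mul]
          have h := hmain x x.2 y hy
          rw [← inv_mul_cancel_left₀ hcase ((geg m j).eval ⟪(x:EuclideanSpace ℝ (Fin m)), y⟫), h,
            Finset.mul_sum, Finset.mul_sum]
          refine Finset.sum_congr rfl fun z _ => ?_
          ring
        rw [this]
        exact Submodule.sum_mem _ fun z hz => Submodule.smul_mem _ _
          (Finset.le_sup (f := U) hsT (hgU s z hz))
      · exact Finset.le_sup (f := U) (Finset.mem_erase.2 ⟨hjk, hj⟩) (hgU j y hy)
    have htop : T.sup U = ⊤ := by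
      rw [eq_top_iff, ← (Pi.basisFun ℝ X).span_eq, Submodule.span_le]
      rintro _ ⟨y, rfl⟩
      have : (Pi.basisFun ℝ X) y = ∑ j ∈ Finset.range (s + 1), f j •
          (fun x : X => (geg m j).eval ⟪(x:EuclideanSpace ℝ (Fin m)), (y:EuclideanSpace ℝ (Fin m))⟫) := by
        ext x
        rw [Finset.sum_apply]
        simp only [Pi.smul_apply, smul_eq_mul]
        rw [hdelta x x.2 y y.2, Pi.basisFun_apply, Pi.single_apply]
        simp only [Subtype.ext_iff]
      rw [this]
      exact Submodule.sum_mem _ fun j hj => Submodule.smul_mem _ _ (hall j hj y y.2)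
    have hfin := finrank_sum_le T U
    rw [htop, finrank_top, Module.finrank_fintype_fun_eq_card, Fintype.card_coe] at hfin
    refine hfin.trans (Finset.sum_le_sum fun j _ => ?_)
    exact (Submodule.finrank_map_le ev (harm m j)).trans (finrank_harm hm)
end

section
/- Let X ⊂ S^{m-1} be a spherical 2-distance set which is a spherical 2-design but not a spherical 3-design. Then |X| ≤ m(m+1)/2. -/
open Polynomial Finset
open scoped RealInnerProductSpace Classical

lemma aux_tight (m : ℕ) (hm : 0 < m) (X : Finset (EuclideanSpace ℝ (Fin m)))
    (hX : ∀ x ∈ X, ‖x‖ = 1)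
    (h2 : ∑ x ∈ X, ∑ y ∈ X, (⟪x, y⟫ : ℝ) ^ 2 = (X.card : ℝ) ^ 2 / m)
    (i j : Fin m) :
    ∑ x ∈ X, x i * x j = if i = j then (X.card : ℝ) / m else 0 := by
  have hm' : (m : ℝ) ≠ 0 := by positivity
  set c : ℝ := (X.card : ℝ) / m with hc
  have hin : ∀ x y : EuclideanSpace ℝ (Fin m), (⟪x, y⟫ : ℝ) = ∑ i, x i * y i := by
    intro x y
    simp [PiLp.inner_apply, mul_comm]
  have hn : ∀ x ∈ X, ∑ i, x i * x i = 1 := by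
    intro x hx
    rw [← hin, real_inner_self_eq_norm_sq, hX x hx]; norm_num
  have e1 : ∑ i : Fin m, ∑ j : Fin m, (∑ x ∈ X, x i * x j) ^ 2 = (X.card : ℝ) ^ 2 / m := by
    rw [← h2]
    simp_rw [hin, sq, Finset.sum_mul_sum]
    rw [Finset.sum_congr rfl (fun i _ => Finset.sum_comm), Finset.sum_comm]
    refine Finset.sum_congr rfl fun x _ => ?_
    rw [Finset.sum_congr rfl (fun i _ => Finset.sum_comm), Finset.sum_comm]
    refine Finset.sum_congr rfl fun y _ => ?_
    refine Finset.sum_congr rfl fun i _ => Finset.sum_congr rfl fun j _ => ?_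
    ring
  have e2 : ∑ i : Fin m, ∑ x ∈ X, x i * x i = X.card := by
    rw [Finset.sum_comm, Finset.sum_congr rfl hn]; simp
  have e3 : ∑ i : Fin m, ∑ j : Fin m,
      ((∑ x ∈ X, x i * x j) - if i = j then c else 0) ^ 2 = 0 := by
    have : ∀ i j : Fin m, ((∑ x ∈ X, x i * x j) - if i = j then c else 0) ^ 2
        = (∑ x ∈ X, x i * x j) ^ 2
          + (if i = j then c ^ 2 - 2 * c * (∑ x ∈ X, x i * x j) else 0) := by
      intro i j
      split_ifs <;> ring
    simp_rw [this, Finset.sum_add_distrib, e1]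
    simp only [Finset.sum_ite_eq, Finset.mem_univ, if_true, Finset.sum_sub_distrib,
      ← Finset.mul_sum, e2]
    simp only [Finset.sum_const, Finset.card_univ, Fintype.card_fin, nsmul_eq_mul]
    rw [hc]; field_simp; ring
  have e4 := (Finset.sum_eq_zero_iff_of_nonneg
    (fun i _ => Finset.sum_nonneg (fun j _ => sq_nonneg _))).1 e3 i (Finset.mem_univ _)
  have e5 := (Finset.sum_eq_zero_iff_of_nonneg (fun j _ => sq_nonneg _)).1 e4 j
    (Finset.mem_univ _)
  exact sub_eq_zero.1 (pow_eq_zero_iff (two_ne_zero) |>.1 e5)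

lemma aux_card (m : ℕ) (X : Finset (EuclideanSpace ℝ (Fin m)))
    (h : ∀ v : EuclideanSpace ℝ (Fin m) → ℝ,
      (∀ i j, ∑ x ∈ X, v x * (x i * x j) = 0) → ∀ x ∈ X, v x = 0) :
    X.card ≤ m * (m + 1) / 2 := by
  let f : X → (Sym2 (Fin m) → ℝ) := fun x p =>
    Sym2.lift ⟨fun i j => x.1 i * x.1 j, fun i j => mul_comm _ _⟩ p
  have hf : LinearIndependent ℝ f := by
    rw [Fintype.linearIndependent_iff]
    intro g hg x
    have := h (fun y => if hy : y ∈ X then g ⟨y, hy⟩ else 0) (by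
      intro i j
      have := congrFun hg s(i, j)
      simp only [Finset.sum_apply, Pi.smul_apply, smul_eq_mul, Pi.zero_apply, f,
        Sym2.lift_mk] at this
      rw [← this, ← Finset.sum_coe_sort X]
      refine Finset.sum_congr rfl fun y _ => ?_
      simp) x.1 x.2
    simpa using this
  have := hf.fintype_card_le_finrank
  rw [Module.finrank_fintype_fun_eq_card, Sym2.card, Fintype.card_coe, Fintype.card_fin,
    Nat.choose_two_right] at this
  simpa [mul_comm] using this

/-- If `X ⊆ S^{m-1}` is a spherical `2`-distance set which is a spherical `2`-design but
not a spherical `3`-design, then `|X| ≤ m(m+1)/2`. -/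
theorem card_two_distance_set_strength_two (m : ℕ)
    (X : Finset (EuclideanSpace ℝ (Fin m))) (hX : ∀ x ∈ X, ‖x‖ = 1)
    (hdist : (innerSet m X).card = 2)
    (hdes : IsGegDesign m 2 X) (hnot : ¬ IsGegDesign m 3 X) :
    X.card ≤ m * (m + 1) / 2 := by
  have hm : 0 < m := by
    rcases Nat.eq_zero_or_pos m with rfl | h
    · have hX0 : X = ∅ := by
        refine Finset.eq_empty_of_forall_notMem fun x hx => ?_
        have h1 := hX x hx
        rw [Subsingleton.elim x 0] at h1
        simp at h1
      subst hX0
      simp [innerSet] at hdist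
    · exact h
  have hm' : (m : ℝ) ≠ 0 := by positivity
  have hm2 : ((m : ℝ) + 2) ≠ 0 := by positivity
  have hm4 : ((m : ℝ) + 4) ≠ 0 := by positivity
  obtain ⟨α, β, hαβ, hset⟩ := Finset.card_eq_two.1 hdist
  have g1 : ∀ t : ℝ, (geg m 1).eval t = m * t := by
    intro t; simp [geg]
  have l2 : (lamG m 2)⁻¹ ≠ 0 := by
    have : (m : ℝ) + 2 * 2 - 2 ≠ 0 := by
      have : (m : ℝ) + 2 * 2 - 2 = m + 2 := by ring
      rwa [this]
    simp only [lamG, Nat.cast_ofNat]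
    exact inv_ne_zero (div_ne_zero two_ne_zero this)
  have g2 : ∀ t : ℝ, (geg m 2).eval t = (lamG m 2)⁻¹ * (m * t ^ 2 - 1) := by
    intro t
    rw [geg, geg, geg]
    simp [lamG]
    left; ring
  have g3 : ∀ t : ℝ, (geg m 3).eval t = (lamG m 3)⁻¹ * (lamG m 2)⁻¹ * m * t ^ 3
      - (lamG m 3)⁻¹ * ((lamG m 2)⁻¹ + (1 - lamG m 1) * m) * t := by
    intro t
    rw [geg]
    simp only [zero_add, Nat.reduceAdd, eval_smul, eval_sub, eval_mul, eval_X, g1, g2, smul_eq_mul]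
    ring
  have d1 : ∑ x ∈ X, ∑ y ∈ X, (⟪x, y⟫ : ℝ) = 0 := by
    have := hdes 1 le_rfl (by norm_num)
    simp_rw [g1, ← Finset.mul_sum] at this
    exact (mul_eq_zero.1 this).resolve_left hm'
  have d2 : ∑ x ∈ X, ∑ y ∈ X, (⟪x, y⟫ : ℝ) ^ 2 = (X.card : ℝ) ^ 2 / m := by
    have := hdes 2 (by norm_num) le_rfl
    simp_rw [g2, ← Finset.mul_sum] at this
    have := (mul_eq_zero.1 this).resolve_left l2
    simp_rw [Finset.sum_sub_distrib, ← Finset.mul_sum] at this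
    simp only [Finset.sum_const, nsmul_eq_mul, mul_one] at this
    rw [eq_div_iff hm']
    linarith
  have d3 : ∑ x ∈ X, ∑ y ∈ X, (⟪x, y⟫ : ℝ) ^ 3 ≠ 0 := by
    intro d3
    apply hnot
    intro i hi hi3
    rcases Nat.lt_or_ge i 3 with h | h
    · exact hdes i hi (by omega)
    · obtain rfl : i = 3 := le_antisymm hi3 h
      simp_rw [g3, Finset.sum_sub_distrib, ← Finset.mul_sum, d3, d1]
      simp
  have hself : ∀ x ∈ X, (⟪x, x⟫ : ℝ) = 1 := by
    intro x hx
    rw [real_inner_self_eq_norm_sq, hX x hx]; norm_num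
  have hne1 : ∀ t ∈ innerSet m X, t ≠ 1 := by
    intro t ht
    simp only [innerSet, Finset.mem_image, Finset.mem_filter, Finset.mem_product] at ht
    obtain ⟨⟨x, y⟩, ⟨⟨hx, hy⟩, hxy⟩, rfl⟩ := ht
    intro h
    exact hxy ((inner_eq_one_iff_of_norm_eq_one (hX x hx) (hX y hy)).1 h)
  have hα : 1 - α ≠ 0 := sub_ne_zero.2 (hne1 α (by simp [hset])).symm
  have hβ : 1 - β ≠ 0 := sub_ne_zero.2 (hne1 β (by simp [hset])).symm
  have hF : ∀ x ∈ X, ∀ y ∈ X, ((⟪x, y⟫ : ℝ) ^ 2 - (α + β) * ⟪x, y⟫ + α * β)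
      = if x = y then (1 - α) * (1 - β) else 0 := by
    intro x hx y hy
    split_ifs with h
    · subst h; rw [hself x hx]; ring
    · have : (⟪x, y⟫ : ℝ) ∈ innerSet m X := by
        simp only [innerSet, Finset.mem_image, Finset.mem_filter, Finset.mem_product]
        exact ⟨(x, y), ⟨⟨hx, hy⟩, h⟩, rfl⟩
      rw [hset, Finset.mem_insert, Finset.mem_singleton] at this
      rcases this with h | h <;> rw [h] <;> ring
  set A : ℝ := (1 - α) * (1 - β) with hA
  have hA0 : A ≠ 0 := mul_ne_zero hα hβ
  set n : ℝ := (X.card : ℝ) with hnn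
  -- the trace identity
  have tr : (∑ x ∈ X, ∑ y ∈ X, (⟪x, y⟫ : ℝ) ^ 3) - (α + β) * (n ^ 2 / m) = A * n := by
    have : ∑ x ∈ X, ∑ y ∈ X, ((⟪x, y⟫ : ℝ) ^ 3 - (α + β) * ⟪x, y⟫ ^ 2 + α * β * ⟪x, y⟫)
        = A * n := by
      have e : ∀ x ∈ X, ∑ y ∈ X,
          ((⟪x, y⟫ : ℝ) ^ 3 - (α + β) * ⟪x, y⟫ ^ 2 + α * β * ⟪x, y⟫) = A := by
        intro x hx
        have : ∀ y ∈ X, ((⟪x, y⟫ : ℝ) ^ 3 - (α + β) * ⟪x, y⟫ ^ 2 + α * β * ⟪x, y⟫)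
            = if x = y then A else 0 := by
          intro y hy
          have h := hF x hx y hy
          have e : ((⟪x, y⟫ : ℝ) ^ 3 - (α + β) * ⟪x, y⟫ ^ 2 + α * β * ⟪x, y⟫)
            = ⟪x, y⟫ * ((⟪x, y⟫ : ℝ) ^ 2 - (α + β) * ⟪x, y⟫ + α * β) := by ring
          rw [e, h]
          split_ifs with hxy
          · subst hxy; rw [hself x hx]; ring
          · ring
        rw [Finset.sum_congr rfl this]
        simp [hx]
      rw [Finset.sum_congr rfl e]
      simp [mul_comm, hnn]
    simp_rw [Finset.sum_add_distrib, Finset.sum_sub_distrib, ← Finset.mul_sum, d1, d2] at this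
    linarith
  have hin : ∀ x y : EuclideanSpace ℝ (Fin m), (⟪x, y⟫ : ℝ) = ∑ i, x i * y i := by
    intro x y
    simp [PiLp.inner_apply, mul_comm]
  have tight := aux_tight m hm X hX d2
  apply aux_card
  intro v hv
  have s0 : ∑ x ∈ X, v x = 0 := by
    have e : ∑ i : Fin m, ∑ x ∈ X, v x * (x i * x i) = 0 :=
      Finset.sum_eq_zero fun i _ => hv i i
    rw [Finset.sum_comm] at e
    rw [← e]
    refine Finset.sum_congr rfl fun x hx => ?_
    rw [← Finset.mul_sum, ← hin, hself x hx, mul_one]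
  have s2 : ∀ y, ∑ x ∈ X, v x * (⟪x, y⟫ : ℝ) ^ 2 = 0 := by
    intro y
    have e : ∑ i : Fin m, ∑ j : Fin m, (∑ x ∈ X, v x * (x i * x j)) * (y i * y j) = 0 :=
      Finset.sum_eq_zero fun i _ => Finset.sum_eq_zero fun j _ => by rw [hv i j, zero_mul]
    rw [← e]
    simp_rw [Finset.sum_mul]
    rw [Finset.sum_congr rfl (fun i _ => Finset.sum_comm), Finset.sum_comm]
    refine Finset.sum_congr rfl fun x _ => ?_
    rw [hin, sq, Finset.sum_mul_sum, Finset.mul_sum]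
    refine Finset.sum_congr rfl fun i _ => ?_
    rw [Finset.mul_sum]
    refine Finset.sum_congr rfl fun j _ => ?_
    ring
  -- `u i` is the vector `∑ v x x`
  set u : Fin m → ℝ := fun i => ∑ x ∈ X, v x * x i with hu
  have hw : ∀ y, ∑ x ∈ X, v x * (⟪x, y⟫ : ℝ) = ∑ i, u i * y i := by
    intro y
    simp_rw [hin, Finset.mul_sum, hu, Finset.sum_mul]
    rw [Finset.sum_comm]
    refine Finset.sum_congr rfl fun i _ => Finset.sum_congr rfl fun x _ => ?_
    ring
  have hvy : ∀ y ∈ X, A * v y = -(α + β) * ∑ i, u i * y i := by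
    intro y hy
    have e : ∑ x ∈ X, v x * ((⟪x, y⟫ : ℝ) ^ 2 - (α + β) * ⟪x, y⟫ + α * β) = A * v y := by
      rw [Finset.sum_congr rfl (fun x hx => by rw [hF x hx y hy])]
      simp [hy, mul_comm]
    have e' : ∑ x ∈ X, v x * ((⟪x, y⟫ : ℝ) ^ 2 - (α + β) * ⟪x, y⟫ + α * β)
        = ∑ x ∈ X, v x * (⟪x, y⟫ : ℝ) ^ 2 - (α + β) * ∑ x ∈ X, v x * (⟪x, y⟫ : ℝ)
          + α * β * ∑ x ∈ X, v x := by
      simp_rw [Finset.mul_sum, ← Finset.sum_sub_distrib, ← Finset.sum_add_distrib]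
      refine Finset.sum_congr rfl fun x _ => ?_
      ring
    rw [s2, s0, hw] at e'
    rw [← e, e']; ring
  have hu0 : ∀ j, u j = 0 := by
    intro j
    have e : A * u j = -(α + β) * (n / m * u j) := by
      have e1 : A * u j = ∑ y ∈ X, (-(α + β) * ∑ i, u i * y i) * y j := by
        simp only [hu, Finset.mul_sum]
        refine Finset.sum_congr rfl fun y hy => ?_
        rw [← mul_assoc, hvy y hy, Finset.mul_sum]
      have e2 : ∑ y ∈ X, (-(α + β) * ∑ i, u i * y i) * y j
          = -(α + β) * ∑ i, u i * ∑ y ∈ X, y i * y j := by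
        simp_rw [Finset.mul_sum, Finset.sum_mul]
        rw [Finset.sum_comm]
        refine Finset.sum_congr rfl fun i _ => Finset.sum_congr rfl fun x _ => ?_
        ring
      rw [e1, e2]
      simp_rw [tight]
      simp [mul_comm, hnn]
    by_contra h
    have e' : A = -(α + β) * (n / m) := mul_right_cancel₀ h (by rw [e]; ring)
    apply d3
    have : (α + β) * (n ^ 2 / m) = -(A * n) := by rw [e']; ring
    linarith
  intro y hy
  have := hvy y hy
  simp only [hu0, zero_mul, Finset.sum_const_zero, mul_zero] at this
  exact (mul_eq_zero.1 this).resolve_left hA0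
end
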